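/- arXiv:2211.04819 — 3 statements merged into one kernel-verified Lean document; each statement's English description precedes it below -/
import Mathlib

section
/- Let d ≥ 3, let V be in the reverse Hölder class RH_q for some q > d/2, let ρ be the associated critical radius function, let 1 < p < ∞, θ > 0, α ∈ [0,1), ν ∈ (1, p'] with p' = p/(p−1), and let w ∈ A_p^{ρ,θ}(ℝ^d). There exist γ > 0 and C > 0 such that for every f ∈ BMO^α_{L,w}(ℝ^d) and every ball B = B(x,r) with r ≥ ρ(x), one has |B|^{−α} ( w(B)^{−1} ∫_B |f(y)|^ν w(y)^{1−ν} dy )^{1/ν} ≤ C (1 + r/ρ(x))^γ ‖f‖_{BMO^α_{L,w}}. -/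
open MeasureTheory Metric

noncomputable section

/-- Euclidean space `ℝ^d`. -/
abbrev Rd (d : ℕ) := EuclideanSpace ℝ (Fin d)

/-- The Lebesgue measure `|B(x,r)|` of a ball, as a real number. -/
noncomputable def ballVol (d : ℕ) (x : Rd d) (r : ℝ) : ℝ :=
  (volume (ball x r)).toReal

/-- The integral `∫_{B(x,r)} g`. -/
noncomputable def ballInt (d : ℕ) (x : Rd d) (r : ℝ) (g : Rd d → ℝ) : ℝ :=
  ∫ y in ball x r, g y

/-- The average `|B(x,r)|⁻¹ ∫_{B(x,r)} g`. -/
noncomputable def ballAvg (d : ℕ) (x : Rd d) (r : ℝ) (g : Rd d → ℝ) : ℝ :=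
  (ballVol d x r)⁻¹ * ballInt d x r g

/-- `V` is a nonnegative, locally integrable, not a.e. zero function in the
reverse Hölder class `RH_q(ℝ^d)`. -/
def IsRH (d : ℕ) (q : ℝ) (V : Rd d → ℝ) : Prop :=
  (∀ x, 0 ≤ V x) ∧ LocallyIntegrable V volume ∧
  ¬ (∀ᵐ x ∂(volume : Measure (Rd d)), V x = 0) ∧
  ∃ C > 0, ∀ x r, 0 < r →
    (ballAvg d x r (fun y => V y ^ q)) ^ (1/q) ≤ C * ballAvg d x r V

/-- The critical radius function `ρ(x) = sup{r > 0 : r^{2-d} ∫_{B(x,r)} V ≤ 1}`. -/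
noncomputable def criticalRadius (d : ℕ) (V : Rd d → ℝ) (x : Rd d) : ℝ :=
  sSup {r : ℝ | 0 < r ∧ r ^ (2 - (d : ℝ)) * ballInt d x r V ≤ 1}

/-- The weight `w` belongs to the class `A_p^{ρ,θ}(ℝ^d)`. -/
def MemAp (d : ℕ) (p θ : ℝ) (ρ : Rd d → ℝ) (w : Rd d → ℝ) : Prop :=
  (∀ x, 0 < w x) ∧ Measurable w ∧ LocallyIntegrable w volume ∧
  LocallyIntegrable (fun x => w x ^ (-(1/(p-1)))) volume ∧
  ∃ C > 0, ∀ x r, 0 < r →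
    (((1 + r / ρ x) ^ θ * ballVol d x r)⁻¹ * ballInt d x r w) *
      (((1 + r / ρ x) ^ θ * ballVol d x r)⁻¹ *
        ballInt d x r (fun y => w y ^ (-(1/(p-1))))) ^ (p-1) ≤ C

/-- `C` is an admissible constant in the definition of `BMO^α_{L,w}` for `f`. -/
def BMOBound (d : ℕ) (α : ℝ) (ρ w f : Rd d → ℝ) (C : ℝ) : Prop :=
  (∀ x₀ r₀, 0 < r₀ → r₀ < ρ x₀ →
    ballInt d x₀ r₀ (fun y => |f y - ballAvg d x₀ r₀ f|) ≤
      C * (ballVol d x₀ r₀ ^ α * ballInt d x₀ r₀ w)) ∧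
  (∀ x₀ r₀, ρ x₀ ≤ r₀ →
    ballInt d x₀ r₀ (fun y => |f y|) ≤
      C * (ballVol d x₀ r₀ ^ α * ballInt d x₀ r₀ w))

/-- `f` belongs to the space `BMO^α_{L,w}(ℝ^d)`. -/
def MemBMO (d : ℕ) (α : ℝ) (ρ w f : Rd d → ℝ) : Prop :=
  LocallyIntegrable f volume ∧ ∃ C > 0, BMOBound d α ρ w f C

/-- The norm `‖f‖_{BMO^α_{L,w}}`: the least admissible constant. -/
noncomputable def bmoNorm (d : ℕ) (α : ℝ) (ρ w f : Rd d → ℝ) : ℝ :=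
  sInf {C : ℝ | 0 < C ∧ BMOBound d α ρ w f C}

open scoped NNReal ENNReal

section Atoms

variable {X ι : Type*}

/-- The atom of generation `k` containing `x`, for a sequence of partitions given by labels. -/
def atom (c : ℕ → X → ι) (k : ℕ) (x : X) : Set X := {y | c k y = c k x}

/-- The average of `f` over the atom of generation `k` containing `x`. -/
noncomputable def atomAvg [MeasurableSpace X] (μ : Measure X) (c : ℕ → X → ι) (f : X → ℝ)
    (k : ℕ) (x : X) : ℝ :=
  ⨍ y in atom c k x, f y ∂μ

theorem self_mem_atom (c : ℕ → X → ι) (k : ℕ) (x : X) : x ∈ atom c k x := rfl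

theorem atom_congr {c : ℕ → X → ι} {k : ℕ} {x y : X} (h : c k y = c k x) :
    atom c k y = atom c k x := by
  simp [atom, h]

theorem atomAvg_congr [MeasurableSpace X] {μ : Measure X} {c : ℕ → X → ι} {f : X → ℝ} {k : ℕ}
    {x y : X} (h : c k y = c k x) : atomAvg μ c f k y = atomAvg μ c f k x := by
  simp [atomAvg, atom_congr h]

theorem measure_mul_enorm_atomAvg_sub_le [MeasurableSpace X] {μ : Measure X} {c : ℕ → X → ι}
    {f : X → ℝ} {k : ℕ} {x : X} (hf : IntegrableOn f (atom c k x) μ) (h0 : μ (atom c k x) ≠ 0)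
    (h1 : μ (atom c k x) ≠ ∞) (b : ℝ) :
    μ (atom c k x) * ‖atomAvg μ c f k x - b‖ₑ ≤ ∫⁻ y in atom c k x, ‖f y - b‖ₑ ∂μ := by
  have hr : μ.real (atom c k x) ≠ 0 := by
    simp [Measure.real, ENNReal.toReal_eq_zero_iff, h0, h1]
  have e : μ.real (atom c k x) * (atomAvg μ c f k x - b) = ∫ y in atom c k x, (f y - b) ∂μ := by
    rw [integral_sub hf (integrableOn_const h1), setIntegral_const, atomAvg, setAverage_eq,
      smul_eq_mul, smul_eq_mul]
    field_simp
  have e2 : μ (atom c k x) = ‖μ.real (atom c k x)‖ₑ := by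
    rw [Real.enorm_of_nonneg measureReal_nonneg, Measure.real, ENNReal.ofReal_toReal h1]
  calc μ (atom c k x) * ‖atomAvg μ c f k x - b‖ₑ
      = ‖μ.real (atom c k x) * (atomAvg μ c f k x - b)‖ₑ := by rw [enorm_mul, ← e2]
    _ ≤ _ := by rw [e]; exact enorm_integral_le_lintegral_enorm _

variable [MeasurableSpace X] [MeasurableSpace ι] [MeasurableSingletonClass ι]

theorem measurableSet_atom {c : ℕ → X → ι} {k : ℕ} (hc : Measurable (c k)) (x : X) :
    MeasurableSet (atom c k x) :=
  hc (measurableSet_singleton _)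

variable [Countable ι]

theorem measurableSet_of_atom_subset {c : ℕ → X → ι} {k : ℕ} (hc : Measurable (c k)) {A : Set X}
    (hA : ∀ x ∈ A, atom c k x ⊆ A) : MeasurableSet A := by
  have h : A = c k ⁻¹' (c k '' A) := by
    refine Set.Subset.antisymm (Set.subset_preimage_image _ _) ?_
    rintro y ⟨x, hx, hxy⟩
    exact hA x hx hxy.symm
  rw [h]
  exact hc (Set.Countable.measurableSet (Set.to_countable _))

/-- Two measures are comparable on a union of atoms as soon as they are so on every atom. -/
theorem measure_le_of_atoms {c : ℕ → X → ι} {k : ℕ} (hc : Measurable (c k)) {A : Set X}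
    (hA : ∀ x ∈ A, atom c k x ⊆ A) {μ₁ μ₂ : Measure X}
    (h : ∀ x ∈ A, μ₁ (atom c k x) ≤ μ₂ (atom c k x)) : μ₁ A ≤ μ₂ A := by
  have hU : A = ⋃ z ∈ c k '' A, c k ⁻¹' {z} := by
    ext y
    simp only [Set.mem_iUnion, Set.mem_preimage, Set.mem_singleton_iff, exists_prop]
    refine ⟨fun hy => ⟨_, ⟨y, hy, rfl⟩, rfl⟩, ?_⟩
    rintro ⟨z, ⟨x, hx, rfl⟩, hxy⟩
    exact hA x hx hxy
  have hd : (c k '' A).PairwiseDisjoint fun z => c k ⁻¹' {z} := by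
    intro z _ z' _ hz
    exact Disjoint.preimage _ (Set.disjoint_singleton.2 hz)
  have hm : ∀ z ∈ c k '' A, MeasurableSet (c k ⁻¹' {z}) := fun z _ => hc (measurableSet_singleton _)
  rw [hU, measure_biUnion (Set.to_countable _) hd hm, measure_biUnion (Set.to_countable _) hd hm]
  refine ENNReal.tsum_le_tsum ?_
  rintro ⟨_, x, hx, rfl⟩
  exact h x hx

theorem measurable_of_atom {β : Type*} [MeasurableSpace β] {c : ℕ → X → ι} {k : ℕ}
    (hc : Measurable (c k)) {g : X → β} (hg : ∀ x y, c k y = c k x → g y = g x) :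
    Measurable g := by
  intro s _
  refine measurableSet_of_atom_subset hc fun x hx y hy => ?_
  simpa [hg x y hy] using hx

end Atoms

theorem exists_quasi_triangle_absorb {s : ℝ} (hs : 1 < s) {C : ℝ≥0} (hC : 1 ≤ C) :
    ∃ D E : ℝ≥0, (∀ a b : ℝ≥0∞, (a + b) ^ s ≤ D * a ^ s + E * b ^ s) ∧
      ∀ u e : ℝ≥0∞, u + e ≤ C * e → D * u + (2 * C : ℝ≥0∞)⁻¹ * (u + e) ≤ u + e := by
  have hC0 : (0 : ℝ) < C := lt_of_lt_of_le one_pos (by exact_mod_cast hC)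
  have hcont : Filter.Tendsto (fun t : ℝ => (1 - t) ^ (1 - s)) (nhdsWithin 0 (Set.Ioi 0))
      (nhds 1) := by
    have : ContinuousAt (fun t : ℝ => (1 - t) ^ (1 - s)) 0 := by
      refine ContinuousAt.rpow_const (by fun_prop) (Or.inl (by norm_num))
    have h := this.tendsto
    simp only [sub_zero, Real.one_rpow] at h
    exact h.mono_left nhdsWithin_le_nhds
  have h1 : ∀ᶠ t : ℝ in nhdsWithin 0 (Set.Ioi 0), (1 - t) ^ (1 - s) < 1 + 1 / (2 * C) :=
    hcont.eventually_lt_const (by have : 0 < 1 / (2 * (C : ℝ)) := by positivity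
                                  linarith)
  have h2 : ∀ᶠ t : ℝ in nhdsWithin 0 (Set.Ioi 0), t ∈ Set.Ioo (0 : ℝ) 1 :=
    Ioo_mem_nhdsGT one_pos
  obtain ⟨t, ht, ht0, ht1⟩ := (h1.and h2).exists
  have key : ∀ r : ℝ, 0 < r → ∀ a : ℝ≥0∞,
      ENNReal.ofReal r * ((ENNReal.ofReal r)⁻¹ * a) ^ s = ENNReal.ofReal (r ^ (1 - s)) * a ^ s := by
    intro r hr a
    rw [ENNReal.mul_rpow_of_nonneg _ _ (by linarith), ← mul_assoc]
    congr 1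
    rw [← ENNReal.ofReal_inv_of_pos hr, ENNReal.ofReal_rpow_of_pos (inv_pos.2 hr),
      ← ENNReal.ofReal_mul hr.le, Real.inv_rpow hr.le, Real.rpow_sub hr, Real.rpow_one,
      div_eq_mul_inv]
  have canc : ∀ r : ℝ, 0 < r → ∀ a : ℝ≥0∞,
      ENNReal.ofReal r * ((ENNReal.ofReal r)⁻¹ * a) = a := by
    intro r hr a
    rw [← mul_assoc, ENNReal.mul_inv_cancel (by simpa using hr) ENNReal.ofReal_ne_top, one_mul]
  refine ⟨Real.toNNReal ((1 - t) ^ (1 - s)), Real.toNNReal (t ^ (1 - s)), fun a b => ?_, ?_⟩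
  · have := ENNReal.rpow_arith_mean_le_arith_mean2_rpow (ENNReal.ofReal (1 - t)) (ENNReal.ofReal t)
      ((ENNReal.ofReal (1 - t))⁻¹ * a) ((ENNReal.ofReal t)⁻¹ * b)
      (by rw [← ENNReal.ofReal_add (by linarith) ht0.le]; simp) hs.le
    rwa [canc _ (by linarith), canc _ ht0, key _ (by linarith), key _ ht0] at this
  · intro u e hue
    by_cases he : e = ∞
    · simp [he]
    have hu : u ≠ ∞ := ne_top_of_le_ne_top (ENNReal.mul_ne_top ENNReal.coe_ne_top he)
      (le_self_add.trans hue)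
    lift u to ℝ≥0 using hu
    lift e to ℝ≥0 using he
    have hC' : C ≠ 0 := by rintro rfl; simp at hC0
    have e1 : (2 * C : ℝ≥0∞)⁻¹ = ((2 * C)⁻¹ : ℝ≥0) := by
      rw [ENNReal.coe_inv (by positivity)]; simp
    rw [e1]
    norm_cast at hue ⊢
    rw [← NNReal.coe_le_coe] at hue ⊢
    push_cast at hue ⊢
    rw [Real.coe_toNNReal _ (Real.rpow_nonneg (by linarith) _)]
    have hu0 : (0 : ℝ) ≤ u := u.2
    have : (1 - t) ^ (1 - s) * (u : ℝ) ≤ (1 + 1 / (2 * C)) * u := by gcongr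
    have h3 : (1 + 1 / (2 * C)) * (u : ℝ) + (2 * (C : ℝ))⁻¹ * (u + e) ≤ u + e := by
      have : (2 * (C : ℝ))⁻¹ * (2 * u + e) ≤ e := by
        rw [inv_mul_le_iff₀ (by positivity)]
        have : (0:ℝ) ≤ e := e.2
        linarith
      have e3 : 1 / (2 * (C : ℝ)) = (2 * (C : ℝ))⁻¹ := by simp
      rw [e3]; linarith
    linarith

section Stopping

variable {X ι : Type*} [MeasurableSpace X]

/-- The set of points of a good atom that lie in a good descendant of generation `m` on which the
mean oscillation about the average is large. -/
def LargeOsc (μ W : Measure X) (c : ℕ → X → ι) (good : ℕ → X → Prop) (f : X → ℝ) (a : ℝ≥0∞)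
    (k : ℕ) (x₀ : X) (N m : ℕ) (x : X) : Prop :=
  k < m ∧ m ≤ N ∧ good m x ∧
    2 * a * (W (atom c k x₀) / μ (atom c k x₀)) * μ (atom c m x) <
      ∫⁻ y in atom c m x, ‖f y - atomAvg μ c f k x₀‖ₑ ∂μ

/-- The points at which `LargeOsc` happens for the first time at generation `m`. -/
def firstLargeOsc (μ W : Measure X) (c : ℕ → X → ι) (good : ℕ → X → Prop) (f : X → ℝ) (a : ℝ≥0∞)
    (k : ℕ) (x₀ : X) (N m : ℕ) : Set X :=
  {x ∈ atom c k x₀ | LargeOsc μ W c good f a k x₀ N m x ∧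
    ∀ j < m, ¬ LargeOsc μ W c good f a k x₀ N j x}

variable {μ W : Measure X} {c : ℕ → X → ι} {good : ℕ → X → Prop} {f : X → ℝ} {a : ℝ≥0∞}

theorem firstLargeOsc_disjoint {k N : ℕ} {x₀ : X} :
    Pairwise (Function.onFun Disjoint (firstLargeOsc μ W c good f a k x₀ N)) := by
  intro m m' hm
  refine Set.disjoint_left.2 ?_
  rintro x ⟨_, hT, hj⟩ ⟨_, hT', hj'⟩
  rcases lt_or_gt_of_ne hm with h | h
  · exact hj' m h hT
  · exact hj m' h hT'

theorem exists_mem_firstLargeOsc {k N m : ℕ} {x₀ x : X} (hx : x ∈ atom c k x₀)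
    (hT : LargeOsc μ W c good f a k x₀ N m x) :
    x ∈ ⋃ m, firstLargeOsc μ W c good f a k x₀ N m := by
  classical
  have hex : ∃ m, LargeOsc μ W c good f a k x₀ N m x := ⟨m, hT⟩
  exact Set.mem_iUnion.2 ⟨Nat.find hex, hx, Nat.find_spec hex, fun j hj => Nat.find_min hex hj⟩

end Stopping

/-- A nested sequence of countable partitions with comparable consecutive atoms, some of which are
marked as good; on the good ones the weights `W`, `S` are dual to each other and `W` is doubling,
and the oscillation of `f` is controlled by `W`. -/
structure GoodAtoms {X ι : Type*} [MeasurableSpace X] [MeasurableSpace ι] (μ W S : Measure X)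
    (c : ℕ → X → ι) (good : ℕ → X → Prop) (f : X → ℝ) (s : ℝ) (P C : ℝ≥0) (a : ℝ≥0∞) : Prop where
  measurable : ∀ k, Measurable (c k)
  nested : ∀ k x y, c (k + 1) x = c (k + 1) y → c k x = c k y
  good_congr : ∀ k x y, c k x = c k y → good k x → good k y
  vol_ne_zero : ∀ k x, μ (atom c k x) ≠ 0
  vol_ne_top : ∀ k x, μ (atom c k x) ≠ ∞
  vol_le : ∀ k x, μ (atom c k x) ≤ P * μ (atom c (k + 1) x)
  weight_ne_zero : ∀ k x, W (atom c k x) ≠ 0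
  weight_ne_top : ∀ k x, W (atom c k x) ≠ ∞
  integrable : ∀ k x, IntegrableOn f (atom c k x) μ
  const_ne_zero : a ≠ 0
  const_ne_top : a ≠ ∞
  osc : ∀ k x, good k x →
    ∫⁻ y in atom c k x, ‖f y - atomAvg μ c f k x‖ₑ ∂μ ≤ a * W (atom c k x)
  size : ∀ k x, good (k + 1) x → ¬ good k x →
    ∫⁻ y in atom c (k + 1) x, ‖f y‖ₑ ∂μ ≤ a * W (atom c (k + 1) x)
  dual : ∀ k x, good k x →
    (W (atom c k x) / μ (atom c k x)) ^ s * S (atom c k x) ≤ C * W (atom c k x)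
  doubling : ∀ k x, good k x → ∀ E ⊆ atom c k x, MeasurableSet E →
    μ (atom c k x) ≤ 2 * μ E → W (atom c k x) ≤ C * W E

namespace GoodAtoms

variable {X ι : Type*} [MeasurableSpace X] [MeasurableSpace ι]
  {μ W S : Measure X} {c : ℕ → X → ι} {good : ℕ → X → Prop} {f : X → ℝ} {s : ℝ} {P C : ℝ≥0}
  {a : ℝ≥0∞}

theorem congr_of_le (h : GoodAtoms μ W S c good f s P C a) {j k : ℕ} (hjk : j ≤ k) {x y : X}
    (hxy : c k x = c k y) : c j x = c j y := by
  induction hjk with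
  | refl => exact hxy
  | step _ ih => exact ih (h.nested _ _ _ hxy)

theorem atom_anti (h : GoodAtoms μ W S c good f s P C a) {j k : ℕ} (hjk : j ≤ k) (x : X) :
    atom c k x ⊆ atom c j x := fun _ hy => h.congr_of_le hjk hy

theorem good_iff (h : GoodAtoms μ W S c good f s P C a) {j k : ℕ} (hjk : j ≤ k) {x y : X}
    (hxy : c k x = c k y) : good j x ↔ good j y :=
  ⟨h.good_congr _ _ _ (h.congr_of_le hjk hxy), h.good_congr _ _ _ (h.congr_of_le hjk hxy).symm⟩

/-- The average of `f` over an atom with controlled size, measured in the dual weight. -/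
theorem lintegral_avg_rpow_le [Countable ι] [MeasurableSingletonClass ι]
    (h : GoodAtoms μ W S c good f s P C a) (hs : 0 < s) {k : ℕ} {A : Set X}
    (hA : ∀ x ∈ A, atom c k x ⊆ A) (hg : ∀ x ∈ A, good k x) (b : ℝ≥0∞) :
    ∫⁻ x in A, (b * (W (atom c k x) / μ (atom c k x))) ^ s ∂S ≤ C * b ^ s * W A := by
  have hm := measurableSet_of_atom_subset (h.measurable k) hA
  rw [← withDensity_apply _ hm, ← smul_eq_mul (_ * _), ← Measure.smul_apply]
  refine measure_le_of_atoms (h.measurable k) hA fun x hx => ?_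
  rw [withDensity_apply _ (measurableSet_atom (h.measurable k) x)]
  calc ∫⁻ y in atom c k x, (b * (W (atom c k y) / μ (atom c k y))) ^ s ∂S
      = ∫⁻ y in atom c k x, (b * (W (atom c k x) / μ (atom c k x))) ^ s ∂S := by
        refine setLIntegral_congr_fun (measurableSet_atom (h.measurable k) x) fun y hy => ?_
        simp only [atom_congr hy]
    _ = b ^ s * ((W (atom c k x) / μ (atom c k x)) ^ s * S (atom c k x)) := by
        rw [setLIntegral_const, ENNReal.mul_rpow_of_nonneg _ _ hs.le, mul_assoc]
    _ ≤ b ^ s * (C * W (atom c k x)) := by gcongr b ^ s * ?_; exact h.dual k x (hg x hx)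
    _ = _ := by rw [Measure.smul_apply, smul_eq_mul]; ring

/-- The average over a good atom with bad parent is controlled by the size of `f`. -/
theorem enorm_avg_le_of_size (h : GoodAtoms μ W S c good f s P C a) {k : ℕ} {x : X} {b : ℝ≥0∞}
    (hb : ∫⁻ y in atom c k x, ‖f y‖ₑ ∂μ ≤ b * W (atom c k x)) :
    ‖atomAvg μ c f k x‖ₑ ≤ b * (W (atom c k x) / μ (atom c k x)) := by
  have := measure_mul_enorm_atomAvg_sub_le (h.integrable k x) (h.vol_ne_zero k x)
    (h.vol_ne_top k x) 0
  simp only [sub_zero] at this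
  rw [← mul_div_assoc, ENNReal.le_div_iff_mul_le (Or.inl (h.vol_ne_zero k x))
    (Or.inl (h.vol_ne_top k x)), mul_comm]
  exact this.trans hb

theorem largeOsc_congr (h : GoodAtoms μ W S c good f s P C a) {k N m j : ℕ} {x₀ x y : X}
    (hj : j ≤ m) (hxy : c m x = c m y) :
    LargeOsc μ W c good f a k x₀ N j x ↔ LargeOsc μ W c good f a k x₀ N j y := by
  unfold LargeOsc
  rw [h.good_iff hj hxy, atom_congr (h.congr_of_le hj hxy)]

theorem firstLargeOsc_saturated (h : GoodAtoms μ W S c good f s P C a) {k N m : ℕ} {x₀ : X} :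
    ∀ x ∈ firstLargeOsc μ W c good f a k x₀ N m,
      atom c m x ⊆ firstLargeOsc μ W c good f a k x₀ N m := by
  rintro x ⟨hx, hT, hj⟩ y hy
  have hy' : c m y = c m x := hy
  refine ⟨?_, (h.largeOsc_congr le_rfl hy').2 hT, fun j hjm => ?_⟩
  · exact (h.congr_of_le hT.1.le hy').trans hx
  · rw [h.largeOsc_congr hjm.le hy']
    exact hj j hjm

/-- The stopping atoms of a good atom cover at most half of it. -/
theorem measure_iUnion_firstLargeOsc_le [Countable ι] [MeasurableSingletonClass ι]
    (h : GoodAtoms μ W S c good f s P C a) {k N : ℕ} {x₀ : X} (hg : good k x₀) :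
    2 * μ (⋃ m, firstLargeOsc μ W c good f a k x₀ N m) ≤ μ (atom c k x₀) := by
  set U := firstLargeOsc μ W c good f a k x₀ N with hU
  set Q := atom c k x₀
  have hm : ∀ m, MeasurableSet (U m) := fun m =>
    measurableSet_of_atom_subset (h.measurable m) h.firstLargeOsc_saturated
  set r : ℝ≥0∞ := a * (W Q / μ Q) with hr
  have hr0 : r ≠ 0 := mul_ne_zero h.const_ne_zero
    (ENNReal.div_ne_zero.2 ⟨h.weight_ne_zero k x₀, h.vol_ne_top k x₀⟩)
  have hrt : r ≠ ∞ := ENNReal.mul_ne_top h.const_ne_top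
    (ENNReal.div_ne_top (h.weight_ne_top k x₀) (h.vol_ne_zero k x₀))
  set ν : Measure X := μ.withDensity fun y => ‖f y - atomAvg μ c f k x₀‖ₑ with hν
  have h1 : ∀ m, ((2 * r) • μ) (U m) ≤ ν (U m) := by
    intro m
    refine measure_le_of_atoms (h.measurable m) h.firstLargeOsc_saturated fun x hx => ?_
    rw [Measure.smul_apply, smul_eq_mul, hν,
      withDensity_apply _ (measurableSet_atom (h.measurable m) x), hr, ← mul_assoc]
    exact hx.2.1.2.2.2.le
  have h2 : (2 * r) * μ (⋃ m, U m) ≤ r * μ Q := by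
    calc (2 * r) * μ (⋃ m, U m) = ((2 * r) • μ) (⋃ m, U m) := rfl
      _ = ∑' m, ((2 * r) • μ) (U m) := measure_iUnion firstLargeOsc_disjoint hm
      _ ≤ ∑' m, ν (U m) := ENNReal.tsum_le_tsum h1
      _ = ν (⋃ m, U m) := (measure_iUnion firstLargeOsc_disjoint hm).symm
      _ ≤ ν Q := measure_mono (Set.iUnion_subset fun m x hx => hx.1)
      _ ≤ a * W Q := by
        rw [hν, withDensity_apply _ (measurableSet_atom (h.measurable k) x₀)]
        exact h.osc k x₀ hg
      _ = r * μ Q := by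
        rw [hr, mul_assoc, ENNReal.div_mul_cancel (h.vol_ne_zero k x₀) (h.vol_ne_top k x₀)]
  rw [mul_comm 2 r, mul_assoc] at h2
  exact (ENNReal.mul_le_mul_iff_right hr0 hrt).1 h2

/-- The jump of the averages between a good atom and its stopping atoms. -/
theorem enorm_atomAvg_sub_le_of_mem_firstLargeOsc (h : GoodAtoms μ W S c good f s P C a)
    {k N m : ℕ} {x₀ x : X} (hg : good k x₀) (hx : x ∈ firstLargeOsc μ W c good f a k x₀ N m) :
    ‖atomAvg μ c f m x‖ₑ - ‖atomAvg μ c f k x₀‖ₑ ≤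
        2 * P * a * (W (atom c k x₀) / μ (atom c k x₀)) ∨
      ‖atomAvg μ c f m x‖ₑ - ‖atomAvg μ c f k x₀‖ₑ ≤
        a * (W (atom c m x) / μ (atom c m x)) := by
  obtain ⟨hxk, ⟨hkm, hmN, hgm, hlt⟩, hj⟩ := hx
  obtain ⟨n, rfl⟩ : ∃ n, m = n + 1 := ⟨m - 1, by omega⟩
  by_cases hgn : good n x
  · left
    set q : ℝ≥0∞ := W (atom c k x₀) / μ (atom c k x₀)
    have hn : ∫⁻ y in atom c n x, ‖f y - atomAvg μ c f k x₀‖ₑ ∂μ ≤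
        2 * a * q * μ (atom c n x) := by
      rcases (Nat.lt_succ_iff.1 hkm).eq_or_lt with rfl | hkn
      · rw [atom_congr hxk, mul_assoc,
          ENNReal.div_mul_cancel (h.vol_ne_zero k x₀) (h.vol_ne_top k x₀)]
        refine (h.osc k x₀ hg).trans ?_
        gcongr
        exact le_mul_of_one_le_left' (by norm_num)
      · have := hj n (Nat.lt_succ_self n)
        unfold LargeOsc at this
        by_contra hcon
        exact this ⟨hkn, by omega, hgn, not_le.1 hcon⟩
    have h1 := measure_mul_enorm_atomAvg_sub_le (h.integrable (n + 1) x)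
      (h.vol_ne_zero (n + 1) x) (h.vol_ne_top (n + 1) x) (atomAvg μ c f k x₀)
    have h2 : μ (atom c (n + 1) x) * ‖atomAvg μ c f (n + 1) x - atomAvg μ c f k x₀‖ₑ ≤
        μ (atom c (n + 1) x) * (2 * P * a * q) := by
      calc _ ≤ _ := h1
        _ ≤ ∫⁻ y in atom c n x, ‖f y - atomAvg μ c f k x₀‖ₑ ∂μ :=
          lintegral_mono_set (h.atom_anti n.le_succ x)
        _ ≤ 2 * a * q * (P * μ (atom c (n + 1) x)) := hn.trans (by gcongr; exact h.vol_le n x)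
        _ = _ := by ring
    have h3 := (ENNReal.mul_le_mul_iff_right (h.vol_ne_zero (n + 1) x)
      (h.vol_ne_top (n + 1) x)).1 h2
    refine le_trans ?_ h3
    rw [tsub_le_iff_right]
    calc ‖atomAvg μ c f (n + 1) x‖ₑ
        = ‖(atomAvg μ c f (n + 1) x - atomAvg μ c f k x₀) + atomAvg μ c f k x₀‖ₑ := by
          rw [sub_add_cancel]
      _ ≤ _ := enorm_add_le _ _
  · right
    exact tsub_le_self.trans (h.enorm_avg_le_of_size (h.size n x hgm hgn))

theorem one_le_const [MeasurableSingletonClass ι] (h : GoodAtoms μ W S c good f s P C a)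
    {k : ℕ} {x : X} (hg : good k x) : 1 ≤ C := by
  have h1 := h.doubling k x hg _ subset_rfl (measurableSet_atom (h.measurable k) x)
    (le_mul_of_one_le_left' (by norm_num))
  have h2 : (1 : ℝ≥0∞) * W (atom c k x) ≤ C * W (atom c k x) := by simpa using h1
  exact_mod_cast (ENNReal.mul_le_mul_iff_left (h.weight_ne_zero k x) (h.weight_ne_top k x)).1 h2

end GoodAtoms

namespace GoodAtoms

variable {X ι : Type*} [MeasurableSpace X] [MeasurableSpace ι] [Countable ι]
  [MeasurableSingletonClass ι]
  {μ W S : Measure X} {c : ℕ → X → ι} {good : ℕ → X → Prop} {f : X → ℝ} {s : ℝ} {P C : ℝ≥0}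
  {a : ℝ≥0∞}

theorem measurable_enorm_atomAvg (h : GoodAtoms μ W S c good f s P C a) (k : ℕ) :
    Measurable fun x => ‖atomAvg μ c f k x‖ₑ :=
  measurable_of_atom (h.measurable k) fun x y hxy => by rw [atomAvg_congr hxy]

theorem measurableSet_good (h : GoodAtoms μ W S c good f s P C a) (k : ℕ) :
    MeasurableSet {x | good k x} :=
  measurableSet_of_atom_subset (h.measurable k) fun x hx y hy =>
    h.good_congr k x y (Eq.symm hy) hx

/-- Passing to the averages on a union of good atoms, the excess over those averages being under
control. -/
theorem setLIntegral_rpow_le_of_excess (h : GoodAtoms μ W S c good f s P C a) (hs : 1 < s)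
    {D E : ℝ≥0} (hDE : ∀ a b : ℝ≥0∞, (a + b) ^ s ≤ D * a ^ s + E * b ^ s) {N m : ℕ} {K : ℝ≥0∞}
    {U : Set X} (hU : ∀ x ∈ U, atom c m x ⊆ U) {φ : X → ℝ≥0∞} {t : ℝ≥0∞}
    (hK : ∀ x ∈ U, ∫⁻ y in atom c m x ∩ {y | good N y},
      (‖atomAvg μ c f N y‖ₑ - ‖atomAvg μ c f m x‖ₑ) ^ s ∂S ≤ K * W (atom c m x))
    (hφ : Measurable φ) (hb : ∀ x ∈ U, ‖atomAvg μ c f m x‖ₑ - t ≤ φ x) :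
    ∫⁻ y in U ∩ {y | good N y}, (‖atomAvg μ c f N y‖ₑ - t) ^ s ∂S ≤
      D * K * W U + E * ∫⁻ y in U, φ y ^ s ∂S := by
  have hs0 : 0 ≤ s := by linarith
  have hm := measurableSet_of_atom_subset (h.measurable m) hU
  have hG := h.measurableSet_good N
  have h1 : ∫⁻ y in U ∩ {y | good N y},
      (‖atomAvg μ c f N y‖ₑ - ‖atomAvg μ c f m y‖ₑ) ^ s ∂S ≤ K * W U := by
    rw [← Measure.restrict_restrict hm, ← withDensity_apply _ hm, ← smul_eq_mul,
      ← Measure.smul_apply]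
    refine measure_le_of_atoms (h.measurable m) hU fun x hx => ?_
    have hmx := measurableSet_atom (h.measurable m) x
    rw [withDensity_apply _ hmx, Measure.restrict_restrict hmx, Measure.smul_apply, smul_eq_mul]
    refine le_trans (le_of_eq ?_) (hK x hx)
    refine setLIntegral_congr_fun (hmx.inter hG) fun y hy => ?_
    simp only [atomAvg_congr hy.1]
  calc ∫⁻ y in U ∩ {y | good N y}, (‖atomAvg μ c f N y‖ₑ - t) ^ s ∂S
      ≤ ∫⁻ y in U ∩ {y | good N y}, (D * (‖atomAvg μ c f N y‖ₑ - ‖atomAvg μ c f m y‖ₑ) ^ s +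
          E * φ y ^ s) ∂S := by
        refine setLIntegral_mono' (hm.inter hG) fun y hy => ?_
        refine le_trans ?_ (hDE _ _)
        gcongr
        refine (tsub_le_tsub_add_tsub (b := ‖atomAvg μ c f m y‖ₑ)).trans ?_
        gcongr
        exact hb y hy.1
    _ = D * ∫⁻ y in U ∩ {y | good N y}, (‖atomAvg μ c f N y‖ₑ - ‖atomAvg μ c f m y‖ₑ) ^ s ∂S +
          E * ∫⁻ y in U ∩ {y | good N y}, φ y ^ s ∂S := by
        rw [lintegral_add_right _ ((hφ.pow_const s).const_mul _),
          lintegral_const_mul' _ _ ENNReal.coe_ne_top, lintegral_const_mul' _ _ ENNReal.coe_ne_top]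
    _ ≤ _ := by
        rw [mul_assoc]
        gcongr
        exact Set.inter_subset_left

theorem measurable_weight_div (h : GoodAtoms μ W S c good f s P C a) (k : ℕ) :
    Measurable fun x => W (atom c k x) / μ (atom c k x) :=
  measurable_of_atom (h.measurable k) fun x y hxy => by rw [atom_congr hxy]

/-- The excess of the averages of generation `N` over the average on a good atom. -/
theorem setLIntegral_excess_le (h : GoodAtoms μ W S c good f s P C a) (hs : 1 < s) {D E : ℝ≥0}
    (hDE : ∀ a b : ℝ≥0∞, (a + b) ^ s ≤ D * a ^ s + E * b ^ s)
    (habs : ∀ u e : ℝ≥0∞, u + e ≤ C * e → D * u + (2 * C : ℝ≥0∞)⁻¹ * (u + e) ≤ u + e) {N k : ℕ}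
    (hkN : k ≤ N) {x₀ : X} (hg : good k x₀) :
    ∫⁻ y in atom c k x₀ ∩ {y | good N y}, (‖atomAvg μ c f N y‖ₑ - ‖atomAvg μ c f k x₀‖ₑ) ^ s ∂S ≤
      2 * C * (2 ^ s * C + E * ((2 * P) ^ s * C + C)) * a ^ s * W (atom c k x₀) := by
  have hs0 : 0 < s := by linarith
  obtain ⟨n, hn⟩ : ∃ n, N - k = n := ⟨_, rfl⟩
  induction n using Nat.strong_induction_on generalizing k x₀ with
  | _ n ih =>
  set Q := atom c k x₀ with hQ
  set q := W Q / μ Q with hq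
  set U := firstLargeOsc μ W c good f a k x₀ N with hU
  set M : ℝ≥0∞ := 2 ^ s * C + E * ((2 * P) ^ s * C + C) with hM
  have hmU : ∀ m, MeasurableSet (U m) := fun m =>
    measurableSet_of_atom_subset (h.measurable m) h.firstLargeOsc_saturated
  have hmQ : MeasurableSet Q := measurableSet_atom (h.measurable k) x₀
  have hG := h.measurableSet_good N
  have hUQ : ⋃ m, U m ⊆ Q := Set.iUnion_subset fun m x hx => hx.1
  have hmUU : MeasurableSet (⋃ m, U m) := MeasurableSet.iUnion hmU
  have hqS : q ^ s * S Q ≤ C * W Q := h.dual k x₀ hg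
  have hout : ∫⁻ y in (Q \ ⋃ m, U m) ∩ {y | good N y},
      (‖atomAvg μ c f N y‖ₑ - ‖atomAvg μ c f k x₀‖ₑ) ^ s ∂S ≤ 2 ^ s * C * a ^ s * W Q := by
    calc _ ≤ ∫⁻ y in (Q \ ⋃ m, U m) ∩ {y | good N y}, (2 * a * q) ^ s ∂S := by
          refine setLIntegral_mono' ((hmQ.diff hmUU).inter hG) fun y hy => ?_
          gcongr
          rcases hkN.eq_or_lt with rfl | hkN
          · rw [atomAvg_congr hy.1.1]; simp
          · have hT : ¬ LargeOsc μ W c good f a k x₀ N N y := fun hT =>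
              hy.1.2 (exists_mem_firstLargeOsc hy.1.1 hT)
            have h1 : ∫⁻ z in atom c N y, ‖f z - atomAvg μ c f k x₀‖ₑ ∂μ ≤
                2 * a * q * μ (atom c N y) := by
              by_contra hcon
              exact hT ⟨hkN, le_rfl, hy.2, not_le.1 hcon⟩
            have h2 := (measure_mul_enorm_atomAvg_sub_le (h.integrable N y) (h.vol_ne_zero N y)
              (h.vol_ne_top N y) _).trans h1
            rw [mul_comm (2 * a * q)] at h2
            have h3 := (ENNReal.mul_le_mul_iff_right (h.vol_ne_zero N y) (h.vol_ne_top N y)).1 h2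
            refine le_trans ?_ h3
            rw [tsub_le_iff_right]
            calc ‖atomAvg μ c f N y‖ₑ
                = ‖(atomAvg μ c f N y - atomAvg μ c f k x₀) + atomAvg μ c f k x₀‖ₑ := by
                  rw [sub_add_cancel]
              _ ≤ _ := enorm_add_le _ _
      _ ≤ (2 * a * q) ^ s * S Q := by
          rw [setLIntegral_const]
          gcongr
          exact Set.inter_subset_left.trans Set.sdiff_subset
      _ = 2 ^ s * a ^ s * (q ^ s * S Q) := by
          rw [ENNReal.mul_rpow_of_nonneg _ _ hs0.le, ENNReal.mul_rpow_of_nonneg _ _ hs0.le]; ring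
      _ ≤ 2 ^ s * a ^ s * (C * W Q) := by gcongr _ * ?_
      _ = _ := by ring
  have hin : ∀ m, ∫⁻ y in U m ∩ {y | good N y},
      (‖atomAvg μ c f N y‖ₑ - ‖atomAvg μ c f k x₀‖ₑ) ^ s ∂S ≤
      D * (2 * C * M * a ^ s) * W (U m) +
        E * ((2 * P * a * q) ^ s * S (U m) + C * a ^ s * W (U m)) := by
    intro m
    refine (h.setLIntegral_rpow_le_of_excess hs hDE h.firstLargeOsc_saturated
      (K := 2 * C * M * a ^ s)
      (φ := fun x => max (2 * P * a * q) (a * (W (atom c m x) / μ (atom c m x)))) ?_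
      (measurable_const.max ((h.measurable_weight_div m).const_mul a)) ?_).trans ?_
    · intro x hx
      have hT := hx.2.1
      have h1 := hT.1
      have h2 := hT.2.1
      exact ih (N - m) (by omega) h2 hT.2.2.1 rfl
    · intro x hx
      rcases h.enorm_atomAvg_sub_le_of_mem_firstLargeOsc hg hx with h1 | h1
      · exact h1.trans (le_max_left _ _)
      · exact h1.trans (le_max_right _ _)
    · gcongr _ + _ * ?_
      calc _ ≤ ∫⁻ y in U m, ((2 * P * a * q) ^ s +
            (a * (W (atom c m y) / μ (atom c m y))) ^ s) ∂S := by
            refine lintegral_mono fun y => ?_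
            rcases max_choice (2 * P * a * q) (a * (W (atom c m y) / μ (atom c m y))) with h1 | h1
            · simp only [h1]; exact le_self_add
            · simp only [h1]; exact le_add_self
        _ ≤ _ := by
            rw [lintegral_add_left measurable_const, setLIntegral_const]
            gcongr _ + ?_
            exact h.lintegral_avg_rpow_le hs0 h.firstLargeOsc_saturated
              (fun x hx => hx.2.1.2.2.1) a
  have hWU : D * W (⋃ m, U m) + (2 * C : ℝ≥0∞)⁻¹ * W Q ≤ W Q := by
    have hsplit : W (⋃ m, U m) + W (Q \ ⋃ m, U m) = W Q := by
      have := measure_inter_add_sdiff (μ := W) Q hmUU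
      rwa [Set.inter_eq_self_of_subset_right hUQ] at this
    rw [← hsplit]
    refine habs _ _ ?_
    rw [hsplit]
    refine h.doubling k x₀ hg _ Set.sdiff_subset (hmQ.diff hmUU) ?_
    have h1 := h.measure_iUnion_firstLargeOsc_le (N := N) hg
    have h2 : μ (⋃ m, U m) + μ (Q \ ⋃ m, U m) = μ Q := by
      have := measure_inter_add_sdiff (μ := μ) Q hmUU
      rwa [Set.inter_eq_self_of_subset_right hUQ] at this
    have h3 : μ Q + μ Q ≤ μ Q + 2 * μ (Q \ ⋃ m, U m) := by
      calc μ Q + μ Q = 2 * μ (⋃ m, U m) + 2 * μ (Q \ ⋃ m, U m) := by rw [← mul_add, h2, two_mul]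
        _ ≤ _ := by gcongr
    exact (ENNReal.add_le_add_iff_left (h.vol_ne_top k x₀)).1 h3
  have hSU : ∑' m, S (U m) ≤ S Q := by
    rw [← measure_iUnion firstLargeOsc_disjoint hmU]
    exact measure_mono hUQ
  have hWU' : ∑' m, W (U m) = W (⋃ m, U m) := (measure_iUnion firstLargeOsc_disjoint hmU).symm
  have hC0 : (2 * C : ℝ≥0∞) ≠ 0 := by
    have : (C : ℝ≥0∞) ≠ 0 := by
      have := h.one_le_const hg
      exact_mod_cast (lt_of_lt_of_le one_pos this).ne'
    simp [this]
  have hCt : (2 * C : ℝ≥0∞) ≠ ∞ := ENNReal.mul_ne_top ENNReal.ofNat_ne_top ENNReal.coe_ne_top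
  have hcover : Q ∩ {y | good N y} ⊆
      ((Q \ ⋃ m, U m) ∩ {y | good N y}) ∪ ⋃ m, (U m ∩ {y | good N y}) := by
    rintro y ⟨hy, hgy⟩
    by_cases hyU : y ∈ ⋃ m, U m
    · obtain ⟨m, hm⟩ := Set.mem_iUnion.1 hyU
      exact Or.inr (Set.mem_iUnion.2 ⟨m, hm, hgy⟩)
    · exact Or.inl ⟨⟨hy, hyU⟩, hgy⟩
  calc _ ≤ _ := lintegral_mono_set hcover
    _ ≤ _ := lintegral_union_le _ _ _
    _ ≤ 2 ^ s * C * a ^ s * W Q + ∑' m, (D * (2 * C * M * a ^ s) * W (U m) +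
        E * ((2 * P * a * q) ^ s * S (U m) + C * a ^ s * W (U m))) :=
      add_le_add hout ((lintegral_iUnion_le _ _).trans (ENNReal.tsum_le_tsum hin))
    _ = 2 ^ s * C * a ^ s * W Q + (D * (2 * C * M * a ^ s) * W (⋃ m, U m) +
        E * ((2 * P * a * q) ^ s * (∑' m, S (U m)) + C * a ^ s * W (⋃ m, U m))) := by
      simp only [ENNReal.tsum_add, ENNReal.tsum_mul_left, hWU']
    _ ≤ 2 ^ s * C * a ^ s * W Q + (D * (2 * C * M * a ^ s) * W (⋃ m, U m) +
        E * ((2 * P * a * q) ^ s * S Q + C * a ^ s * W Q)) := by gcongr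
    _ = 2 ^ s * C * a ^ s * W Q + (D * (2 * C * M * a ^ s) * W (⋃ m, U m) +
        E * ((2 * P) ^ s * a ^ s * (q ^ s * S Q) + C * a ^ s * W Q)) := by
      rw [ENNReal.mul_rpow_of_nonneg _ q hs0.le, ENNReal.mul_rpow_of_nonneg _ a hs0.le]; ring
    _ ≤ 2 ^ s * C * a ^ s * W Q + (D * (2 * C * M * a ^ s) * W (⋃ m, U m) +
        E * ((2 * P) ^ s * a ^ s * (C * W Q) + C * a ^ s * W Q)) := by
      gcongr _ + (_ + _ * (_ * ?_ + _))
    _ = D * (2 * C * M * a ^ s) * W (⋃ m, U m) + M * a ^ s * W Q := by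
      rw [hM]; ring
    _ = D * (2 * C * M * a ^ s) * W (⋃ m, U m) +
        (2 * C * (2 * C : ℝ≥0∞)⁻¹) * (M * a ^ s * W Q) := by
      rw [ENNReal.mul_inv_cancel hC0 hCt, one_mul]
    _ = 2 * C * M * a ^ s * (D * W (⋃ m, U m) + (2 * C : ℝ≥0∞)⁻¹ * W Q) := by ring
    _ ≤ _ := by gcongr

end GoodAtoms

namespace GoodAtoms

variable {X ι : Type*} [MeasurableSpace X] [MeasurableSpace ι] [Countable ι]
  [MeasurableSingletonClass ι]
  {μ W S : Measure X} {c : ℕ → X → ι} {good : ℕ → X → Prop} {f : X → ℝ} {s : ℝ} {P C : ℝ≥0}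
  {a b : ℝ≥0∞}

/-- Weighted bound for the averages of generation `N`, summing over the first good atoms. -/
theorem setLIntegral_avg_le (h : GoodAtoms μ W S c good f s P C a) (hs : 1 < s) {D E : ℝ≥0}
    (hDE : ∀ a b : ℝ≥0∞, (a + b) ^ s ≤ D * a ^ s + E * b ^ s)
    (habs : ∀ u e : ℝ≥0∞, u + e ≤ C * e → D * u + (2 * C : ℝ≥0∞)⁻¹ * (u + e) ≤ u + e)
    {A : Set X} (hA : ∀ x ∈ A, atom c 0 x ⊆ A) (hab : a ≤ b)
    (hb : ∀ x ∈ A, good 0 x → ∫⁻ y in atom c 0 x, ‖f y‖ₑ ∂μ ≤ b * W (atom c 0 x)) (N : ℕ) :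
    ∫⁻ y in A ∩ {y | good N y}, ‖atomAvg μ c f N y‖ₑ ^ s ∂S ≤
      (D * (2 * C * (2 ^ s * C + E * ((2 * P) ^ s * C + C))) + E * C) * b ^ s * W A := by
  have hs0 : 0 < s := by linarith
  set M : ℝ≥0∞ := 2 * C * (2 ^ s * C + E * ((2 * P) ^ s * C + C))
  set U : ℕ → Set X := fun m => {x ∈ A | good m x ∧ ∀ j < m, ¬ good j x}
  have hU : ∀ m, ∀ x ∈ U m, atom c m x ⊆ U m := by
    rintro m x ⟨hx, hgx, hj⟩ y hy
    have hy' : c m y = c m x := hy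
    exact ⟨hA x hx (h.congr_of_le m.zero_le hy'), (h.good_iff le_rfl hy').2 hgx,
      fun j hjm => fun hgy => hj j hjm ((h.good_iff hjm.le hy').1 hgy)⟩
  have hmU : ∀ m, MeasurableSet (U m) := fun m =>
    measurableSet_of_atom_subset (h.measurable m) (hU m)
  have hd : Pairwise (Function.onFun Disjoint U) := by
    intro m m' hm
    refine Set.disjoint_left.2 ?_
    rintro x ⟨_, hT, hj⟩ ⟨_, hT', hj'⟩
    rcases lt_or_gt_of_ne hm with h | h
    · exact hj' m h hT
    · exact hj m' h hT'
  have hin : ∀ m, ∫⁻ y in U m ∩ {y | good N y}, ‖atomAvg μ c f N y‖ₑ ^ s ∂S ≤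
      (D * M + E * C) * b ^ s * W (U m) := by
    intro m
    rcases le_or_gt m N with hmN | hmN
    · have h1 := h.setLIntegral_rpow_le_of_excess hs hDE (hU m) (N := N) (t := 0)
        (K := M * a ^ s) (φ := fun x => b * (W (atom c m x) / μ (atom c m x)))
        (fun x hx => h.setLIntegral_excess_le hs hDE habs hmN hx.2.1)
        ((h.measurable_weight_div m).const_mul b) (fun x hx => ?_)
      · simp only [tsub_zero] at h1
        calc _ ≤ _ := h1
          _ ≤ D * (M * b ^ s) * W (U m) + E * (C * b ^ s * W (U m)) := by
            gcongr _ * (_ * ?_) * _ + _ * ?_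
            · gcongr
            · exact h.lintegral_avg_rpow_le hs0 (hU m) (fun x hx => hx.2.1) b
          _ = _ := by ring
      · rw [tsub_zero]
        refine h.enorm_avg_le_of_size ?_
        rcases m with _ | n
        · exact hb x hx.1 hx.2.1
        · exact (h.size n x hx.2.1 (hx.2.2 n n.lt_succ_self)).trans (by gcongr)
    · have : U m ∩ {y | good N y} = ∅ := by
        ext y
        simp only [Set.mem_inter_iff, Set.mem_ofPred_eq, Set.mem_empty_iff_false,
          iff_false, not_and]
        exact fun hy => hy.2.2 N hmN
      simp [this]
  have hcover : A ∩ {y | good N y} ⊆ ⋃ m, (U m ∩ {y | good N y}) := by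
    classical
    rintro y ⟨hy, hgy⟩
    have hex : ∃ m, good m y := ⟨N, hgy⟩
    exact Set.mem_iUnion.2
      ⟨Nat.find hex, ⟨hy, Nat.find_spec hex, fun j hj => Nat.find_min hex hj⟩, hgy⟩
  calc _ ≤ _ := lintegral_mono_set hcover
    _ ≤ _ := lintegral_iUnion_le _ _
    _ ≤ _ := ENNReal.tsum_le_tsum hin
    _ = (D * M + E * C) * b ^ s * W (⋃ m, U m) := by
      rw [ENNReal.tsum_mul_left, measure_iUnion hd hmU]
    _ ≤ _ := by
      gcongr
      exact Set.iUnion_subset fun m x hx => hx.1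

/-- Weighted self-improvement of the oscillation bounds. -/
theorem setLIntegral_rpow_le (h : GoodAtoms μ W S c good f s P C a) (hs : 1 < s) {D E : ℝ≥0}
    (hDE : ∀ a b : ℝ≥0∞, (a + b) ^ s ≤ D * a ^ s + E * b ^ s)
    (habs : ∀ u e : ℝ≥0∞, u + e ≤ C * e → D * u + (2 * C : ℝ≥0∞)⁻¹ * (u + e) ≤ u + e)
    {A : Set X} (hA : ∀ x ∈ A, atom c 0 x ⊆ A) (hab : a ≤ b)
    (hb : ∀ x ∈ A, good 0 x → ∫⁻ y in atom c 0 x, ‖f y‖ₑ ∂μ ≤ b * W (atom c 0 x))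
    (hgood : ∀ x, ∀ᶠ N in Filter.atTop, good N x)
    (hlim : ∀ᵐ x ∂S, Filter.Tendsto (fun N => atomAvg μ c f N x) Filter.atTop (nhds (f x))) :
    ∫⁻ y in A, ‖f y‖ₑ ^ s ∂S ≤
      (D * (2 * C * (2 ^ s * C + E * ((2 * P) ^ s * C + C))) + E * C) * b ^ s * W A := by
  set g : ℕ → X → ℝ≥0∞ := fun N => {y | good N y}.indicator fun y => ‖atomAvg μ c f N y‖ₑ ^ s
  have hg : ∀ N, Measurable (g N) := fun N =>
    ((h.measurable_enorm_atomAvg N).pow_const s).indicator (h.measurableSet_good N)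
  have hgl : ∀ᵐ x ∂(S.restrict A), ‖f x‖ₑ ^ s = Filter.liminf (fun N => g N x) Filter.atTop := by
    filter_upwards [ae_restrict_of_ae hlim] with x hx
    have h1 : Filter.Tendsto (fun N => ‖atomAvg μ c f N x‖ₑ ^ s) Filter.atTop
        (nhds (‖f x‖ₑ ^ s)) :=
      ((ENNReal.continuous_rpow_const.comp continuous_enorm).tendsto (f x)).comp hx
    refine (Filter.Tendsto.liminf_eq (h1.congr' ?_)).symm
    filter_upwards [hgood x] with N hN
    simp only [g]
    rw [Set.indicator_of_mem (show x ∈ {y | good N y} from hN)]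
  rw [lintegral_congr_ae hgl]
  refine (lintegral_liminf_le hg).trans ?_
  refine Filter.liminf_le_of_le (by isBoundedDefault) fun t ht => ?_
  obtain ⟨N, hN⟩ := ht.exists
  refine hN.trans ?_
  rw [lintegral_indicator (h.measurableSet_good N),
    Measure.restrict_restrict (h.measurableSet_good N),
    Set.inter_comm]
  exact h.setLIntegral_avg_le hs hDE habs hA hab hb N

end GoodAtoms

section Cubes

variable {d : ℕ}

/-- The label of the cube of side `s / 2 ^ k` of the standard grid that contains `x`. -/
noncomputable def cubeIndex (d : ℕ) (s : ℝ) (k : ℕ) (x : Rd d) : Fin d → ℤ :=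
  fun i => ⌊x i / (s / 2 ^ k)⌋

theorem measurable_cubeIndex (s : ℝ) (k : ℕ) : Measurable (cubeIndex d s k) := by
  refine measurable_pi_lambda _ fun i => ?_
  exact Int.measurable_floor.comp (by fun_prop)

theorem cubeIndex_nested {s : ℝ} {k : ℕ} {x y : Rd d}
    (h : cubeIndex d s (k + 1) x = cubeIndex d s (k + 1) y) :
    cubeIndex d s k x = cubeIndex d s k y := by
  have key : ∀ t : ℝ, ⌊t / (s / 2 ^ k)⌋ = ⌊t / (s / 2 ^ (k + 1))⌋ / (2 : ℕ) := by
    intro t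
    rw [← Int.floor_div_natCast]
    congr 1
    rw [pow_succ]
    push_cast
    rcases eq_or_ne s 0 with rfl | hs
    · simp
    · field_simp
  funext i
  have := congrFun h i
  simp only [cubeIndex] at this ⊢
  rw [key, key, this]

theorem abs_sub_lt_of_cubeIndex_eq {s : ℝ} (hs : 0 < s) {k : ℕ} {x y : Rd d}
    (h : cubeIndex d s k y = cubeIndex d s k x) (i : Fin d) : |y i - x i| < s / 2 ^ k := by
  have hl : 0 < s / 2 ^ k := by positivity
  have := Int.abs_sub_lt_one_of_floor_eq_floor (congrFun h i)
  rw [← sub_div, abs_div, abs_of_pos hl, div_lt_one hl] at this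
  exact this

theorem atom_cubeIndex_subset_ball {s : ℝ} (hs : 0 < s) (k : ℕ) {x y : Rd d}
    (hy : y ∈ atom (cubeIndex d s) k x) :
    atom (cubeIndex d s) k x ⊆ ball y ((d + 1) * (s / 2 ^ k)) := by
  intro z hz
  have hl : 0 < s / 2 ^ k := by positivity
  have h : ∀ i, |z i - y i| < s / 2 ^ k := abs_sub_lt_of_cubeIndex_eq hs (Eq.trans hz (Eq.symm hy))
  rw [mem_ball, EuclideanSpace.dist_eq, Real.sqrt_lt' (by positivity)]
  calc ∑ i, dist (z i) (y i) ^ 2 ≤ ∑ _i : Fin d, (s / 2 ^ k) ^ 2 := by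
        gcongr with i
        exact (h i).le
    _ = d * (s / 2 ^ k) ^ 2 := by simp
    _ < ((d + 1) * (s / 2 ^ k)) ^ 2 := by
        rw [mul_pow]
        gcongr
        have : (0 : ℝ) ≤ d := d.cast_nonneg
        nlinarith

theorem volume_atom_cubeIndex {s : ℝ} (hs : 0 < s) (k : ℕ) (x : Rd d) :
    volume (atom (cubeIndex d s) k x) = ENNReal.ofReal ((s / 2 ^ k) ^ d) := by
  have hl : 0 < s / 2 ^ k := by positivity
  set l := s / 2 ^ k with hldef
  have he : atom (cubeIndex d s) k x = (MeasurableEquiv.toLp 2 (Fin d → ℝ)).symm ⁻¹'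
      (Set.univ.pi fun i => Set.Ico (l * ⌊x i / l⌋) (l * ⌊x i / l⌋ + l)) := by
    ext y
    simp only [atom, cubeIndex, Set.mem_ofPred_eq, funext_iff, Set.mem_preimage, Set.mem_pi,
      Set.mem_univ, true_imp_iff, Set.mem_Ico, MeasurableEquiv.coe_toLp_symm]
    refine forall_congr' fun i => ?_
    rw [Int.floor_eq_iff, ← hldef, le_div_iff₀ hl, div_lt_iff₀ hl, add_mul, one_mul,
      mul_comm l]
  rw [he, (EuclideanSpace.volume_preserving_symm_measurableEquiv_toLp (Fin d)).measure_preimage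
    (MeasurableSet.univ_pi fun i => measurableSet_Ico).nullMeasurableSet, Real.volume_pi_Ico]
  simp [ENNReal.ofReal_pow hl.le]

theorem volume_ball_eq_mul_volume_atom {s : ℝ} (hs : 0 < s) (k : ℕ) (x y : Rd d) {R : ℝ}
    (hR : 0 < R) :
    volume (ball y (R * (s / 2 ^ k))) =
      ENNReal.ofReal (R ^ d) * volume (ball (0 : Rd d) 1) * volume (atom (cubeIndex d s) k x) := by
  rw [volume_atom_cubeIndex hs, Measure.addHaar_ball_of_pos _ _ (by positivity),
    finrank_euclideanSpace_fin, mul_pow, ENNReal.ofReal_mul (by positivity)]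
  ring

/-- Averages over shrinking cubes converge almost everywhere. -/
theorem ae_tendsto_atomAvg_cubeIndex {s : ℝ} (hs : 0 < s) {f : Rd d → ℝ}
    (hf : LocallyIntegrable f volume) :
    ∀ᵐ x, Filter.Tendsto (fun N => atomAvg volume (cubeIndex d s) f N x) Filter.atTop
      (nhds (f x)) := by
  filter_upwards [IsUnifLocDoublingMeasure.ae_tendsto_average_norm_sub volume hf 1] with x hx
  have hδ : Filter.Tendsto (fun N : ℕ => ((d : ℝ) + 1) * (s / 2 ^ N)) Filter.atTop
      (nhdsWithin 0 (Set.Ioi 0)) := by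
    refine tendsto_nhdsWithin_iff.2 ⟨?_, Filter.Eventually.of_forall fun N => ?_⟩
    · have h1 := (tendsto_pow_atTop_nhds_zero_of_lt_one (r := (1 / 2 : ℝ)) (by norm_num)
        (by norm_num)).const_mul (((d : ℝ) + 1) * s)
      rw [mul_zero] at h1
      refine h1.congr fun N => ?_
      rw [one_div, inv_pow]
      ring
    · exact Set.mem_Ioi.2 (by positivity)
  have h2 := hx (fun _ : ℕ => x) _ hδ (Filter.Eventually.of_forall fun N => by
    rw [one_mul]
    exact mem_closedBall_self (by positivity))
  rw [tendsto_iff_norm_sub_tendsto_zero]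
  set κ : ℝ := (ENNReal.ofReal (((d : ℝ) + 1) ^ d) * volume (ball (0 : Rd d) 1)).toReal with hκ
  have h3 := h2.const_mul κ
  rw [mul_zero] at h3
  refine squeeze_zero (fun _ => norm_nonneg _) (fun N => ?_) h3
  set Q := atom (cubeIndex d s) N x with hQ
  set B := closedBall x (((d : ℝ) + 1) * (s / 2 ^ N)) with hB
  have hQB : Q ⊆ B :=
    (atom_cubeIndex_subset_ball hs N (self_mem_atom _ N x)).trans ball_subset_closedBall
  have hfB : IntegrableOn f B volume := hf.integrableOn_isCompact (isCompact_closedBall _ _)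
  have hQ0 : volume Q ≠ 0 := by
    rw [hQ, volume_atom_cubeIndex hs]
    simpa using by positivity
  have hQt : volume Q ≠ ∞ := by rw [hQ, volume_atom_cubeIndex hs]; exact ENNReal.ofReal_ne_top
  have hBt : volume B ≠ ∞ := measure_closedBall_lt_top.ne
  have h4 := (measure_mul_enorm_atomAvg_sub_le (c := cubeIndex d s) (hfB.mono_set hQB)
    hQ0 hQt (f x)).trans (lintegral_mono_set hQB)
  have hint : IntegrableOn (fun y => f y - f x) B volume := hfB.sub (integrableOn_const hBt)
  rw [← ofReal_integral_norm_eq_lintegral_enorm hint] at h4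
  have h5 := ENNReal.toReal_mono ENNReal.ofReal_ne_top h4
  rw [ENNReal.toReal_mul, toReal_enorm,
    ENNReal.toReal_ofReal (integral_nonneg fun _ => norm_nonneg _)] at h5
  have hBQ : volume.real B = κ * volume.real Q := by
    rw [hκ, measureReal_def, measureReal_def, ← ENNReal.toReal_mul, hQ,
      ← volume_ball_eq_mul_volume_atom hs N x x (by positivity), hB,
      Measure.addHaar_closedBall _ _ (by positivity),
      Measure.addHaar_ball_of_pos _ x (by positivity)]
  have hQpos : 0 < volume.real Q := ENNReal.toReal_pos hQ0 hQt
  rw [setAverage_eq, smul_eq_mul, hBQ]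
  have hκ0 : 0 < κ := by
    refine ENNReal.toReal_pos (mul_ne_zero ?_ (measure_ball_pos _ _ one_pos).ne')
      (ENNReal.mul_ne_top ENNReal.ofReal_ne_top measure_ball_lt_top.ne)
    simpa using by positivity
  calc _ ≤ (volume.real Q)⁻¹ * ∫ y in B, ‖f y - f x‖ := by
        rw [le_inv_mul_iff₀ hQpos]; exact h5
    _ = _ := by field_simp

end Cubes

section Weights

variable {d : ℕ}

/-- The measure with density `w` with respect to Lebesgue measure. -/
noncomputable def weightMeasure (w : Rd d → ℝ) : Measure (Rd d) :=
  volume.withDensity fun x => ENNReal.ofReal (w x)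

theorem weightMeasure_ball {w : Rd d → ℝ} (hw : ∀ x, 0 < w x) (hl : LocallyIntegrable w volume)
    (x : Rd d) (r : ℝ) : weightMeasure w (ball x r) = ENNReal.ofReal (ballInt d x r w) := by
  have hi : IntegrableOn w (ball x r) volume :=
    (hl.integrableOn_isCompact (isCompact_closedBall x r)).mono_set ball_subset_closedBall
  rw [weightMeasure, withDensity_apply _ measurableSet_ball, ballInt,
    ofReal_integral_eq_lintegral_ofReal hi (Filter.Eventually.of_forall fun y => (hw y).le)]

theorem weightMeasure_ne_zero {w : Rd d → ℝ} (hw : ∀ x, 0 < w x) (hm : Measurable w)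
    {E : Set (Rd d)} (hE : volume E ≠ 0) : weightMeasure w E ≠ 0 := by
  intro h
  rw [weightMeasure, withDensity_apply_eq_zero (by fun_prop)] at h
  refine hE ?_
  have : {x | ENNReal.ofReal (w x) ≠ 0} = Set.univ := by
    ext x
    simp [hw x]
  rwa [this, Set.univ_inter] at h

theorem ofReal_ballVol (x : Rd d) (r : ℝ) : ENNReal.ofReal (ballVol d x r) = volume (ball x r) :=
  ENNReal.ofReal_toReal measure_ball_lt_top.ne

theorem ballVol_pos (x : Rd d) {r : ℝ} (hr : 0 < r) : 0 < ballVol d x r :=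
  ENNReal.toReal_pos (measure_ball_pos _ _ hr).ne' measure_ball_lt_top.ne

theorem ballInt_pos {w : Rd d → ℝ} (hw : ∀ x, 0 < w x) (hm : Measurable w)
    (hl : LocallyIntegrable w volume) (x : Rd d) {r : ℝ} (hr : 0 < r) : 0 < ballInt d x r w := by
  have := weightMeasure_ne_zero hw hm (measure_ball_pos volume x hr).ne'
  rw [weightMeasure_ball hw hl] at this
  simpa using this

theorem volume_rpow_le {w : Rd d → ℝ} {p : ℝ} (hp : 1 < p) (hw : ∀ x, 0 < w x)
    (hm : Measurable w) {E : Set (Rd d)} (hE : MeasurableSet E) :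
    volume E ^ p ≤
      weightMeasure w E * weightMeasure (fun x => w x ^ (-(1 / (p - 1)))) E ^ (p - 1) := by
  have hp0 : 0 < p := by linarith
  have hp1 : 0 < p - 1 := by linarith
  have hpq : p.HolderConjugate (p / (p - 1)) := Real.HolderConjugate.conjExponent hp
  have h := ENNReal.lintegral_mul_le_Lp_mul_Lq (volume.restrict E) hpq
    (f := fun x => ENNReal.ofReal (w x ^ (1 / p))) (g := fun x => ENNReal.ofReal (w x ^ (-(1 / p))))
    (by fun_prop) (by fun_prop)
  have h1 : ∀ x, ENNReal.ofReal (w x ^ (1 / p)) * ENNReal.ofReal (w x ^ (-(1 / p))) = 1 := by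
    intro x
    have := (hw x).le
    rw [← ENNReal.ofReal_mul (by positivity), ← Real.rpow_add (hw x)]
    simp
  have h2 : ∀ x, ENNReal.ofReal (w x ^ (1 / p)) ^ p = ENNReal.ofReal (w x) := by
    intro x
    have := (hw x).le
    rw [ENNReal.ofReal_rpow_of_nonneg (by positivity) hp0.le, ← Real.rpow_mul this,
      one_div_mul_cancel hp0.ne', Real.rpow_one]
  have h3 : ∀ x, ENNReal.ofReal (w x ^ (-(1 / p))) ^ (p / (p - 1)) =
      ENNReal.ofReal (w x ^ (-(1 / (p - 1)))) := by
    intro x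
    have := (hw x).le
    rw [ENNReal.ofReal_rpow_of_nonneg (by positivity) (by positivity), ← Real.rpow_mul this]
    congr 2
    field_simp
  simp only [Pi.mul_apply, h1, h2, h3, lintegral_const, one_mul, Measure.restrict_apply_univ] at h
  rw [← withDensity_apply _ hE, ← withDensity_apply _ hE] at h
  calc volume E ^ p ≤ _ := ENNReal.rpow_le_rpow h hp0.le
    _ = _ := by
      rw [ENNReal.mul_rpow_of_nonneg _ _ hp0.le, ← ENNReal.rpow_mul, ← ENNReal.rpow_mul,
        one_div_mul_cancel hp0.ne', ENNReal.rpow_one, one_div_div, div_mul_cancel₀ _ hp0.ne']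
      rfl

theorem MemAp.exists_mul_rpow_le {p θ : ℝ} {ρ w : Rd d → ℝ} (hw : MemAp d p θ ρ w) (hp : 1 < p)
    (hρ : ∀ x, 0 < ρ x) : ∃ A : ℝ≥0, ∀ (x : Rd d) (r : ℝ), 0 < r →
      weightMeasure w (ball x r) *
          weightMeasure (fun x => w x ^ (-(1 / (p - 1)))) (ball x r) ^ (p - 1) ≤
        A * ENNReal.ofReal (1 + r / ρ x) ^ (p * θ) * volume (ball x r) ^ p := by
  obtain ⟨hpos, hm, hl, hl', A, hA, h⟩ := hw
  refine ⟨A.toNNReal, fun x r hr => ?_⟩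
  have hp1 : 0 < p - 1 := by linarith
  have hp0 : 0 < p := by linarith
  have hΦ : 0 < 1 + r / ρ x := by have := hρ x; positivity
  have hv := ballVol_pos x hr
  have hI := ballInt_pos hpos hm hl x hr
  have hpos' : ∀ x, 0 < w x ^ (-(1 / (p - 1))) := fun x => Real.rpow_pos_of_pos (hpos x) _
  have hJ := ballInt_pos hpos' (by fun_prop) hl' x hr
  have h1 := h x r hr
  rw [weightMeasure_ball hpos hl, weightMeasure_ball hpos' hl', ← ofReal_ballVol]
  set I := ballInt d x r w
  set J := ballInt d x r fun x => w x ^ (-(1 / (p - 1)))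
  set v := ballVol d x r
  set Φ := 1 + r / ρ x
  have hu : 0 < Φ ^ θ * v := by positivity
  rw [Real.mul_rpow (by positivity) hJ.le, Real.inv_rpow hu.le] at h1
  have h2 : I * J ^ (p - 1) ≤ A * (Φ ^ θ * v) ^ p := by
    have h3 : (Φ ^ θ * v) ^ p = (Φ ^ θ * v) * (Φ ^ θ * v) ^ (p - 1) := by
      rw [← Real.rpow_one_add' hu.le (by linarith)]
      congr 1
      ring
    rw [h3]
    calc I * J ^ (p - 1) = ((Φ ^ θ * v)⁻¹ * I * (((Φ ^ θ * v) ^ (p - 1))⁻¹ * J ^ (p - 1))) *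
          (Φ ^ θ * v * (Φ ^ θ * v) ^ (p - 1)) := by field_simp
      _ ≤ _ := by gcongr
  rw [Real.mul_rpow (by positivity) hv.le, ← Real.rpow_mul hΦ.le, mul_comm θ] at h2
  rw [ENNReal.ofReal_rpow_of_pos hJ, ENNReal.ofReal_rpow_of_pos hΦ, ENNReal.ofReal_rpow_of_pos hv,
    ← ENNReal.ofReal_mul hI.le, ← ENNReal.ofReal_coe_nnreal, Real.coe_toNNReal _ hA.le,
    ← ENNReal.ofReal_mul hA.le, ← ENNReal.ofReal_mul (by positivity), mul_assoc]
  exact ENNReal.ofReal_le_ofReal h2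

end Weights

section Oscillation

variable {d : ℕ}

theorem volume_rpow_mul_weightMeasure_le {w : Rd d → ℝ} {p : ℝ} (hp : 1 < p) (hw : ∀ x, 0 < w x)
    (hm : Measurable w) {E B : Set (Rd d)} (hE : MeasurableSet E) (hEB : E ⊆ B) {K : ℝ≥0∞}
    (h : weightMeasure w B * weightMeasure (fun x => w x ^ (-(1 / (p - 1)))) B ^ (p - 1) ≤ K) :
    volume E ^ p * weightMeasure w B ≤ K * weightMeasure w E := by
  have hp1 : 0 ≤ p - 1 := by linarith
  calc volume E ^ p * weightMeasure w B
      ≤ weightMeasure w E * weightMeasure (fun x => w x ^ (-(1 / (p - 1)))) B ^ (p - 1) *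
          weightMeasure w B := by
        gcongr
        exact (volume_rpow_le hp hw hm hE).trans (by gcongr)
    _ = weightMeasure w B * weightMeasure (fun x => w x ^ (-(1 / (p - 1)))) B ^ (p - 1) *
          weightMeasure w E := by ring
    _ ≤ _ := by gcongr

theorem ofReal_ballInt_abs {g : Rd d → ℝ} {x : Rd d} {r : ℝ}
    (hg : IntegrableOn g (ball x r) volume) :
    ENNReal.ofReal (ballInt d x r fun y => |g y|) = ∫⁻ y in ball x r, ‖g y‖ₑ :=
  ofReal_integral_norm_eq_lintegral_enorm hg

theorem BMOBound.ofReal_le {w : Rd d → ℝ} {α A : ℝ} (hw : ∀ x, 0 < w x)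
    (hl : LocallyIntegrable w volume) (hA : 0 ≤ A) {x : Rd d} {r : ℝ} (hr : 0 < r) {t : ℝ}
    (ht : t ≤ A * (ballVol d x r ^ α * ballInt d x r w)) :
    ENNReal.ofReal t ≤
      ENNReal.ofReal A * (volume (ball x r) ^ α * weightMeasure w (ball x r)) := by
  have hv := ballVol_pos x hr
  rw [weightMeasure_ball hw hl, ← ofReal_ballVol, ENNReal.ofReal_rpow_of_pos hv,
    ← ENNReal.ofReal_mul (by positivity), ← ENNReal.ofReal_mul hA]
  exact ENNReal.ofReal_le_ofReal ht

theorem BMOBound.lintegral_le {ρ w f : Rd d → ℝ} {α A : ℝ} (h : BMOBound d α ρ w f A)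
    (hf : LocallyIntegrable f volume) (hw : ∀ x, 0 < w x) (hl : LocallyIntegrable w volume)
    (hA : 0 ≤ A) {x : Rd d} {r : ℝ} (hr : 0 < r) (hρ : ρ x ≤ r) :
    ∫⁻ y in ball x r, ‖f y‖ₑ ≤
      ENNReal.ofReal A * (volume (ball x r) ^ α * weightMeasure w (ball x r)) := by
  have hi : IntegrableOn f (ball x r) volume :=
    (hf.integrableOn_isCompact (isCompact_closedBall x r)).mono_set ball_subset_closedBall
  rw [← ofReal_ballInt_abs hi]
  exact BMOBound.ofReal_le hw hl hA hr (h.2 x r hρ)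

theorem BMOBound.exists_lintegral_sub_le {ρ w f : Rd d → ℝ} {α A : ℝ} (h : BMOBound d α ρ w f A)
    (hf : LocallyIntegrable f volume) (hw : ∀ x, 0 < w x) (hl : LocallyIntegrable w volume)
    (hA : 0 ≤ A) (x : Rd d) {r : ℝ} (hr : 0 < r) :
    ∃ m : ℝ, ∫⁻ y in ball x r, ‖f y - m‖ₑ ≤
      ENNReal.ofReal A * (volume (ball x r) ^ α * weightMeasure w (ball x r)) := by
  rcases le_or_gt (ρ x) r with hρ | hρ
  · exact ⟨0, by simpa using h.lintegral_le hf hw hl hA hr hρ⟩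
  · have hi : IntegrableOn f (ball x r) volume :=
      (hf.integrableOn_isCompact (isCompact_closedBall x r)).mono_set ball_subset_closedBall
    refine ⟨ballAvg d x r f, ?_⟩
    rw [← ofReal_ballInt_abs (g := fun y => f y - ballAvg d x r f)
      (hi.sub (integrableOn_const measure_ball_lt_top.ne))]
    exact BMOBound.ofReal_le hw hl hA hr (h.1 x r hr hρ)

/-- The dimensional ratio between the volume of the ball of radius `3 (d + 1)` times the side of a
cube and the volume of the cube. -/
noncomputable def ballCubeRatio (d : ℕ) : ℝ≥0∞ :=
  ENNReal.ofReal ((3 * ((d : ℝ) + 1)) ^ d) * volume (ball (0 : Rd d) 1)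

theorem ballCubeRatio_ne_zero (d : ℕ) : ballCubeRatio d ≠ 0 :=
  mul_ne_zero (by simpa using by positivity) (measure_ball_pos _ _ one_pos).ne'

theorem ballCubeRatio_ne_top (d : ℕ) : ballCubeRatio d ≠ ∞ :=
  ENNReal.mul_ne_top ENNReal.ofReal_ne_top measure_ball_lt_top.ne

/-- The cube of generation `k` containing `x` has a point whose critical radius is at least
comparable to the side of the cube. -/
def GoodCube (d : ℕ) (s : ℝ) (ρ : Rd d → ℝ) (k : ℕ) (x : Rd d) : Prop :=
  ∃ y ∈ atom (cubeIndex d s) k x, ((d : ℝ) + 1) * (s / 2 ^ k) ≤ ρ y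

theorem goodCube_eventually {s : ℝ} {ρ : Rd d → ℝ} (hρ : ∀ x, 0 < ρ x)
    (x : Rd d) : ∀ᶠ N in Filter.atTop, GoodCube d s ρ N x := by
  have h1 := (tendsto_pow_atTop_nhds_zero_of_lt_one (r := (1 / 2 : ℝ)) (by norm_num)
    (by norm_num)).const_mul (((d : ℝ) + 1) * s)
  rw [mul_zero] at h1
  filter_upwards [h1.eventually (eventually_le_nhds (hρ x))] with N hN
  refine ⟨x, self_mem_atom _ N x, le_trans (le_of_eq ?_) hN⟩
  rw [one_div, inv_pow]
  ring

theorem measurableSet_atom_cubeIndex (s : ℝ) (k : ℕ) (x : Rd d) :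
    MeasurableSet (atom (cubeIndex d s) k x) :=
  measurable_cubeIndex s k (measurableSet_singleton _)

theorem volume_atom_ne_zero {s : ℝ} (hs : 0 < s) (k : ℕ) (x : Rd d) :
    volume (atom (cubeIndex d s) k x) ≠ 0 := by
  rw [volume_atom_cubeIndex hs]
  simpa using by positivity

theorem volume_atom_ne_top {s : ℝ} (hs : 0 < s) (k : ℕ) (x : Rd d) :
    volume (atom (cubeIndex d s) k x) ≠ ∞ := by
  rw [volume_atom_cubeIndex hs]
  exact ENNReal.ofReal_ne_top

theorem GoodCube.exists_ball {s p θ : ℝ} {ρ w : Rd d → ℝ} {A : ℝ≥0} (hs : 0 < s)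
    (hp : 1 < p) (hθ : 0 < θ)
    (hA : ∀ (x : Rd d) (r : ℝ), 0 < r →
      weightMeasure w (ball x r) *
          weightMeasure (fun x => w x ^ (-(1 / (p - 1)))) (ball x r) ^ (p - 1) ≤
        A * ENNReal.ofReal (1 + r / ρ x) ^ (p * θ) * volume (ball x r) ^ p)
    {k : ℕ} {x : Rd d} (h : GoodCube d s ρ k x) :
    ∃ y : Rd d, atom (cubeIndex d s) k x ⊆ ball y (((d : ℝ) + 1) * (s / 2 ^ k)) ∧
      volume (ball y (3 * ((d : ℝ) + 1) * (s / 2 ^ k))) =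
        ballCubeRatio d * volume (atom (cubeIndex d s) k x) ∧
      weightMeasure w (ball y (3 * ((d : ℝ) + 1) * (s / 2 ^ k))) *
          weightMeasure (fun x => w x ^ (-(1 / (p - 1))))
            (ball y (3 * ((d : ℝ) + 1) * (s / 2 ^ k))) ^ (p - 1) ≤
        A * 4 ^ (p * θ) * ballCubeRatio d ^ p * volume (atom (cubeIndex d s) k x) ^ p := by
  obtain ⟨y, hy, hyρ⟩ := h
  have hl : 0 < s / 2 ^ k := by positivity
  have hv : volume (ball y (3 * ((d : ℝ) + 1) * (s / 2 ^ k))) =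
      ballCubeRatio d * volume (atom (cubeIndex d s) k x) :=
    volume_ball_eq_mul_volume_atom hs k x y (by positivity)
  refine ⟨y, atom_cubeIndex_subset_ball hs k hy, hv, (hA y _ (by positivity)).trans ?_⟩
  have hp0 : 0 < p := by linarith
  rw [hv, ENNReal.mul_rpow_of_nonneg _ _ hp0.le, ← mul_assoc]
  have hρy : 0 < ρ y := lt_of_lt_of_le (by positivity) hyρ
  gcongr
  rw [show (4 : ℝ≥0∞) = ENNReal.ofReal 4 by simp]
  refine ENNReal.ofReal_le_ofReal ?_
  have : 3 * ((d : ℝ) + 1) * (s / 2 ^ k) / ρ y ≤ 3 := by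
    rw [div_le_iff₀ hρy]
    linarith
  linarith

theorem goodAtoms_cubeIndex {s p θ α M : ℝ} {ρ w f : Rd d → ℝ} {A C : ℝ≥0} (hs : 0 < s)
    (hp : 1 < p) (hθ : 0 < θ) (hα : 0 ≤ α) (hw : ∀ x, 0 < w x) (hm : Measurable w)
    (hl : LocallyIntegrable w volume)
    (hA : ∀ (x : Rd d) (r : ℝ), 0 < r →
      weightMeasure w (ball x r) *
          weightMeasure (fun x => w x ^ (-(1 / (p - 1)))) (ball x r) ^ (p - 1) ≤
        A * ENNReal.ofReal (1 + r / ρ x) ^ (p * θ) * volume (ball x r) ^ p)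
    (hf : LocallyIntegrable f volume) (hM : 0 < M) (hfM : BMOBound d α ρ w f M)
    (hC : 1 ≤ C) (hC1 : 2 ^ p * (A * 4 ^ (p * θ) * ballCubeRatio d ^ p) ≤ C)
    (hC2 : (A * 4 ^ (p * θ) * ballCubeRatio d ^ p) ^ (1 / (p - 1)) ≤ C) :
    GoodAtoms volume (weightMeasure w) (weightMeasure fun x => w x ^ (-(1 / (p - 1))))
      (cubeIndex d s) (GoodCube d s ρ) f (p / (p - 1)) (2 ^ d) C
      (2 * (ENNReal.ofReal M * ((ballCubeRatio d * ENNReal.ofReal (s ^ d)) ^ α * C))) := by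
  have hp0 : 0 < p := by linarith
  have hp1 : 0 < p - 1 := by linarith
  set L := (A : ℝ≥0∞) * 4 ^ (p * θ) * ballCubeRatio d ^ p with hL
  have hLC : L ≤ C := by
    refine le_trans ?_ hC1
    calc L = 1 * L := (one_mul L).symm
      _ ≤ _ := by
        gcongr
        exact ENNReal.one_le_rpow (by norm_num) hp0
  have hv : ∀ k (x : Rd d), volume (atom (cubeIndex d s) k x) ≤ ENNReal.ofReal (s ^ d) := by
    intro k x
    rw [volume_atom_cubeIndex hs]
    gcongr
    exact div_le_self hs.le (one_le_pow₀ (by norm_num))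
  have hWQ : ∀ k (x y : Rd d), atom (cubeIndex d s) k x ⊆ ball y (((d : ℝ) + 1) * (s / 2 ^ k)) →
      weightMeasure w (ball y (3 * ((d : ℝ) + 1) * (s / 2 ^ k))) *
          weightMeasure (fun x => w x ^ (-(1 / (p - 1))))
            (ball y (3 * ((d : ℝ) + 1) * (s / 2 ^ k))) ^ (p - 1) ≤
        L * volume (atom (cubeIndex d s) k x) ^ p → ∀ E ⊆ atom (cubeIndex d s) k x,
      MeasurableSet E → volume E ^ p * weightMeasure w (ball y (3 * ((d : ℝ) + 1) * (s / 2 ^ k))) ≤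
        L * volume (atom (cubeIndex d s) k x) ^ p * weightMeasure w E := by
    intro k x y h1 h2 E hE hEm
    refine volume_rpow_mul_weightMeasure_le hp hw hm hEm ((hE.trans h1).trans ?_) h2
    refine ball_subset_ball ?_
    have : 0 < ((d : ℝ) + 1) * (s / 2 ^ k) := by positivity
    linarith
  have hsub : ∀ k (x y : Rd d), atom (cubeIndex d s) k x ⊆ ball y (((d : ℝ) + 1) * (s / 2 ^ k)) →
      atom (cubeIndex d s) k x ⊆ ball y (3 * ((d : ℝ) + 1) * (s / 2 ^ k)) := by
    intro k x y h
    refine h.trans (ball_subset_ball ?_)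
    have : 0 < ((d : ℝ) + 1) * (s / 2 ^ k) := by positivity
    linarith
  have hvp0 : ∀ k (x : Rd d), volume (atom (cubeIndex d s) k x) ^ p ≠ 0 := fun k x =>
    (ENNReal.rpow_pos (pos_iff_ne_zero.2 (volume_atom_ne_zero hs k x))
      (volume_atom_ne_top hs k x)).ne'
  have hvpt : ∀ k (x : Rd d), volume (atom (cubeIndex d s) k x) ^ p ≠ ∞ := fun k x =>
    ENNReal.rpow_ne_top_of_nonneg hp0.le (volume_atom_ne_top hs k x)
  have hmain : ∀ k (x y : Rd d),
      atom (cubeIndex d s) k x ⊆ ball y (((d : ℝ) + 1) * (s / 2 ^ k)) →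
      volume (ball y (3 * ((d : ℝ) + 1) * (s / 2 ^ k))) =
        ballCubeRatio d * volume (atom (cubeIndex d s) k x) →
      weightMeasure w (ball y (3 * ((d : ℝ) + 1) * (s / 2 ^ k))) *
          weightMeasure (fun x => w x ^ (-(1 / (p - 1))))
            (ball y (3 * ((d : ℝ) + 1) * (s / 2 ^ k))) ^ (p - 1) ≤
        L * volume (atom (cubeIndex d s) k x) ^ p →
      ENNReal.ofReal M * (volume (ball y (3 * ((d : ℝ) + 1) * (s / 2 ^ k))) ^ α *
        weightMeasure w (ball y (3 * ((d : ℝ) + 1) * (s / 2 ^ k)))) ≤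
      (ENNReal.ofReal M * ((ballCubeRatio d * ENNReal.ofReal (s ^ d)) ^ α * C)) *
        weightMeasure w (atom (cubeIndex d s) k x) := by
    intro k x y h1 h2 h3
    have h4 : weightMeasure w (ball y (3 * ((d : ℝ) + 1) * (s / 2 ^ k))) ≤
        C * weightMeasure w (atom (cubeIndex d s) k x) := by
      have := hWQ k x y h1 h3 _ subset_rfl (measurableSet_atom_cubeIndex s k x)
      rw [mul_comm L, mul_assoc (volume _ ^ p) L,
        ENNReal.mul_le_mul_iff_right (hvp0 k x) (hvpt k x)] at this
      exact this.trans (by gcongr)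
    calc _ ≤ ENNReal.ofReal M * ((ballCubeRatio d * ENNReal.ofReal (s ^ d)) ^ α *
          (C * weightMeasure w (atom (cubeIndex d s) k x))) := by
          rw [h2]
          gcongr
          exact hv k x
      _ = _ := by ring
  have hsd : ENNReal.ofReal (s ^ d) ≠ 0 := by simpa using by positivity
  refine ⟨measurable_cubeIndex s, fun k x y h => cubeIndex_nested h, ?_, volume_atom_ne_zero hs,
    volume_atom_ne_top hs, ?_, fun k x => weightMeasure_ne_zero hw hm (volume_atom_ne_zero hs k x),
    ?_, ?_, ?_, ?_, ?_, ?_, ?_, ?_⟩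
  · rintro k x y hxy ⟨z, hz, hzρ⟩
    exact ⟨z, Eq.trans hz hxy, hzρ⟩
  · intro k x
    rw [volume_atom_cubeIndex hs, volume_atom_cubeIndex hs, ← ENNReal.ofReal_coe_nnreal,
      ← ENNReal.ofReal_mul (by positivity)]
    refine ENNReal.ofReal_le_ofReal (le_of_eq ?_)
    push_cast
    rw [← mul_pow]
    congr 1
    rw [pow_succ]
    field_simp
  · intro k x
    refine ne_top_of_le_ne_top ?_ (measure_mono (atom_cubeIndex_subset_ball hs k
      (self_mem_atom _ k x)))
    rw [weightMeasure_ball hw hl]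
    exact ENNReal.ofReal_ne_top
  · intro k x
    exact (hf.integrableOn_isCompact (isCompact_closedBall x _)).mono_set
      ((atom_cubeIndex_subset_ball hs k (self_mem_atom _ k x)).trans ball_subset_closedBall)
  · have h1 : (ballCubeRatio d * ENNReal.ofReal (s ^ d)) ^ α ≠ 0 :=
      (ENNReal.rpow_pos (pos_iff_ne_zero.2 (mul_ne_zero (ballCubeRatio_ne_zero d) hsd))
        (ENNReal.mul_ne_top (ballCubeRatio_ne_top d) ENNReal.ofReal_ne_top)).ne'
    have h2 : (C : ℝ≥0∞) ≠ 0 := by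
      have : C ≠ 0 := (zero_lt_one.trans_le hC).ne'
      exact_mod_cast this
    refine mul_ne_zero two_ne_zero (mul_ne_zero ?_ (mul_ne_zero h1 h2))
    simpa using hM
  · have h1 : (ballCubeRatio d * ENNReal.ofReal (s ^ d)) ^ α ≠ ∞ :=
      ENNReal.rpow_ne_top_of_nonneg hα
        (ENNReal.mul_ne_top (ballCubeRatio_ne_top d) ENNReal.ofReal_ne_top)
    exact ENNReal.mul_ne_top ENNReal.ofNat_ne_top (ENNReal.mul_ne_top ENNReal.ofReal_ne_top
      (ENNReal.mul_ne_top h1 ENNReal.coe_ne_top))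
  · intro k x hx
    obtain ⟨y, h1, h2, h3⟩ := hx.exists_ball hs hp hθ hA
    obtain ⟨m, hm'⟩ := hfM.exists_lintegral_sub_le hf hw hl hM.le y
      (r := 3 * ((d : ℝ) + 1) * (s / 2 ^ k)) (by positivity)
    have h4 := hm'.trans (hmain k x y h1 h2 h3)
    have h5 := (lintegral_mono_set (hsub k x y h1)).trans h4
    have h6 := measure_mul_enorm_atomAvg_sub_le (c := cubeIndex d s) (μ := volume) (k := k) (x := x)
      (f := f)
      ((hf.integrableOn_isCompact (isCompact_closedBall x _)).mono_set
        ((atom_cubeIndex_subset_ball hs k (self_mem_atom _ k x)).trans ball_subset_closedBall))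
      (volume_atom_ne_zero hs k x) (volume_atom_ne_top hs k x) m
    calc ∫⁻ z in atom (cubeIndex d s) k x, ‖f z - atomAvg volume (cubeIndex d s) f k x‖ₑ
        ≤ ∫⁻ z in atom (cubeIndex d s) k x,
            (‖f z - m‖ₑ + ‖atomAvg volume (cubeIndex d s) f k x - m‖ₑ) := by
          refine lintegral_mono fun z => ?_
          rw [← sub_sub_sub_cancel_right (f z) _ m]
          exact enorm_sub_le
      _ = (∫⁻ z in atom (cubeIndex d s) k x, ‖f z - m‖ₑ) +
            volume (atom (cubeIndex d s) k x) *
              ‖atomAvg volume (cubeIndex d s) f k x - m‖ₑ := by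
          rw [lintegral_add_right _ measurable_const, lintegral_const,
            Measure.restrict_apply_univ, mul_comm (volume _)]
      _ ≤ _ := by
          rw [mul_assoc 2, two_mul]
          exact add_le_add h5 (h6.trans h5)
  · intro k x hx hnx
    obtain ⟨y, h1, h2, h3⟩ := hx.exists_ball hs hp hθ hA
    have hρx : ρ x ≤ 2 * ((d : ℝ) + 1) * (s / 2 ^ (k + 1)) := by
      by_contra! hlt
      refine hnx ⟨x, self_mem_atom _ k x, le_trans (le_of_eq ?_) hlt.le⟩
      rw [pow_succ]
      field_simp
    have hl' : 0 < s / 2 ^ (k + 1) := by positivity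
    have hsub1 : atom (cubeIndex d s) (k + 1) x ⊆
        ball x (2 * ((d : ℝ) + 1) * (s / 2 ^ (k + 1))) := by
      refine (atom_cubeIndex_subset_ball hs _ (self_mem_atom _ _ x)).trans (ball_subset_ball ?_)
      have : 0 < ((d : ℝ) + 1) * (s / 2 ^ (k + 1)) := by positivity
      linarith
    have hsub2 : ball x (2 * ((d : ℝ) + 1) * (s / 2 ^ (k + 1))) ⊆
        ball y (3 * ((d : ℝ) + 1) * (s / 2 ^ (k + 1))) := by
      refine ball_subset_ball' ?_
      have := mem_ball.1 (h1 (self_mem_atom _ _ x))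
      linarith
    calc _ ≤ ∫⁻ z in ball x (2 * ((d : ℝ) + 1) * (s / 2 ^ (k + 1))), ‖f z‖ₑ :=
          lintegral_mono_set hsub1
      _ ≤ _ := hfM.lintegral_le hf hw hl hM.le (by positivity) hρx
      _ ≤ _ := by gcongr
      _ ≤ _ := hmain _ x y h1 h2 h3
      _ ≤ _ := by
          rw [mul_assoc 2, two_mul]
          exact le_self_add
  · intro k x hx
    obtain ⟨y, h1, h2, h3⟩ := hx.exists_ball hs hp hθ hA
    set Q := atom (cubeIndex d s) k x
    set T := weightMeasure fun x => w x ^ (-(1 / (p - 1)))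
    have h4 : weightMeasure w Q * T Q ^ (p - 1) ≤ L * volume Q ^ p := by
      refine le_trans ?_ h3
      gcongr <;> exact hsub k x y h1
    have h5 := ENNReal.rpow_le_rpow h4 (z := 1 / (p - 1)) (by positivity)
    rw [ENNReal.mul_rpow_of_nonneg _ _ (by positivity),
      ENNReal.mul_rpow_of_nonneg _ _ (by positivity), ← ENNReal.rpow_mul, ← ENNReal.rpow_mul,
      mul_one_div_cancel hp1.ne', ENNReal.rpow_one, mul_one_div] at h5
    have hpp : p / (p - 1) = 1 + 1 / (p - 1) := by field_simp; ring
    have hvσ0 : volume Q ^ (p / (p - 1)) ≠ 0 :=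
      (ENNReal.rpow_pos (pos_iff_ne_zero.2 (volume_atom_ne_zero hs k x))
        (volume_atom_ne_top hs k x)).ne'
    have hvσt : volume Q ^ (p / (p - 1)) ≠ ∞ :=
      ENNReal.rpow_ne_top_of_nonneg (by positivity) (volume_atom_ne_top hs k x)
    have h6 : weightMeasure w Q ^ (p / (p - 1)) =
        weightMeasure w Q * weightMeasure w Q ^ (1 / (p - 1)) := by
      rw [hpp, ENNReal.rpow_add_of_nonneg _ _ zero_le_one (by positivity), ENNReal.rpow_one]
    rw [ENNReal.div_rpow_of_nonneg _ _ (by positivity), ENNReal.div_eq_inv_mul, mul_assoc,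
      ENNReal.inv_mul_le_iff hvσ0 hvσt, h6]
    calc _ = weightMeasure w Q * (weightMeasure w Q ^ (1 / (p - 1)) * T Q) := by ring
      _ ≤ weightMeasure w Q * (L ^ (1 / (p - 1)) * volume Q ^ (p / (p - 1))) := by gcongr
      _ ≤ weightMeasure w Q * (C * volume Q ^ (p / (p - 1))) := by gcongr
      _ = _ := by ring
  · intro k x hx E hE hEm hE2
    obtain ⟨y, h1, h2, h3⟩ := hx.exists_ball hs hp hθ hA
    have h4 := hWQ k x y h1 h3 E hE hEm
    set Q := atom (cubeIndex d s) k x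
    rw [← ENNReal.mul_le_mul_iff_right (hvp0 k x) (hvpt k x)]
    calc volume Q ^ p * weightMeasure w Q
        ≤ (2 * volume E) ^ p * weightMeasure w (ball y (3 * ((d : ℝ) + 1) * (s / 2 ^ k))) := by
          gcongr
          exact hsub k x y h1
      _ = 2 ^ p * (volume E ^ p *
            weightMeasure w (ball y (3 * ((d : ℝ) + 1) * (s / 2 ^ k)))) := by
          rw [ENNReal.mul_rpow_of_nonneg _ _ hp0.le, mul_assoc]
      _ ≤ 2 ^ p * (L * volume Q ^ p * weightMeasure w E) := by gcongr
      _ = volume Q ^ p * (2 ^ p * L * weightMeasure w E) := by ring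
      _ ≤ _ := by gcongr

end Oscillation

section SelfImprovement

variable {d : ℕ}

theorem weightMeasure_ball_le {p θ : ℝ} {ρ w : Rd d → ℝ} {A : ℝ≥0} (hp : 1 < p) (hθ : 0 < θ)
    (hw : ∀ x, 0 < w x) (hm : Measurable w)
    (hA : ∀ (x : Rd d) (r : ℝ), 0 < r →
      weightMeasure w (ball x r) *
          weightMeasure (fun x => w x ^ (-(1 / (p - 1)))) (ball x r) ^ (p - 1) ≤
        A * ENNReal.ofReal (1 + r / ρ x) ^ (p * θ) * volume (ball x r) ^ p)
    {x : Rd d} {r R : ℝ} (hr : 0 < r) (hR : 1 ≤ R) {E : Set (Rd d)} (hE : MeasurableSet E)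
    (hEB : E ⊆ ball x (R * r)) (hE0 : volume E ≠ 0) {τ : ℝ≥0∞}
    (hτ : volume (ball x (R * r)) = τ * volume E) :
    weightMeasure w (ball x (R * r)) ≤ A * ENNReal.ofReal R ^ (p * θ) * τ ^ p *
      ENNReal.ofReal (1 + r / ρ x) ^ (p * θ) * weightMeasure w E := by
  have hp0 : 0 < p := by linarith
  have hEt : volume E ≠ ∞ := ne_top_of_le_ne_top measure_ball_lt_top.ne (measure_mono hEB)
  have h1 := volume_rpow_mul_weightMeasure_le hp hw hm hE hEB (hA x (R * r) (by positivity))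
  have h2 : ENNReal.ofReal (1 + R * r / ρ x) ≤
      ENNReal.ofReal R * ENNReal.ofReal (1 + r / ρ x) := by
    rw [← ENNReal.ofReal_mul (by linarith)]
    refine ENNReal.ofReal_le_ofReal ?_
    rw [mul_add, mul_one, mul_div_assoc]
    linarith
  rw [← ENNReal.mul_le_mul_iff_right (ENNReal.rpow_pos (pos_iff_ne_zero.2 hE0) hEt).ne'
    (ENNReal.rpow_ne_top_of_nonneg hp0.le hEt)]
  refine h1.trans ?_
  calc _ ≤ A * (ENNReal.ofReal R * ENNReal.ofReal (1 + r / ρ x)) ^ (p * θ) *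
        (τ * volume E) ^ p * weightMeasure w E := by
        rw [hτ]
        gcongr
    _ = _ := by
        rw [ENNReal.mul_rpow_of_nonneg _ _ hp0.le, ENNReal.mul_rpow_of_nonneg _ _ (by positivity)]
        ring

theorem MemAp.exists_lintegral_rpow_le {p θ α : ℝ} {ρ w : Rd d → ℝ} (hw : MemAp d p θ ρ w)
    (hp : 1 < p) (hθ : 0 < θ) (hα : 0 ≤ α) (hρ : ∀ x, 0 < ρ x) :
    ∃ K : ℝ≥0∞, K ≠ ∞ ∧ ∀ (f : Rd d → ℝ) (M : ℝ), LocallyIntegrable f volume → 0 < M →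
      BMOBound d α ρ w f M → ∀ (x : Rd d) (r : ℝ), ρ x ≤ r →
      ∫⁻ y in ball x r, ‖f y‖ₑ ^ (p / (p - 1)) ∂(weightMeasure fun x => w x ^ (-(1 / (p - 1)))) ≤
        K * (ENNReal.ofReal M * volume (ball x r) ^ α) ^ (p / (p - 1)) *
          ENNReal.ofReal (1 + r / ρ x) ^ (p * θ * (p / (p - 1)) + p * θ) *
          weightMeasure w (ball x r) := by
  obtain ⟨A, hA⟩ := hw.exists_mul_rpow_le hp hρ
  obtain ⟨hpos, hm, hl, -⟩ := hw
  have hp0 : 0 < p := by linarith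
  have hp1 : 0 < p - 1 := by linarith
  set σ := p / (p - 1) with hσdef
  have hσ : 1 < σ := by rw [hσdef, one_lt_div hp1]; linarith
  have hσ0 : 0 < σ := by linarith
  set κ := ballCubeRatio d with hκ
  have hκt : κ ≠ ∞ := ballCubeRatio_ne_top d
  set R : ℝ := (d : ℝ) + 1 + 1 with hR
  have hR1 : 1 ≤ R := by
    have : (0 : ℝ) ≤ d := d.cast_nonneg
    linarith
  set τ := ENNReal.ofReal (R ^ d) with hτ
  set L₀ : ℝ≥0∞ := A * 4 ^ (p * θ) * κ ^ p with hL₀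
  set L₁ : ℝ≥0∞ := A * ENNReal.ofReal R ^ (p * θ) * κ ^ p with hL₁
  set L₂ : ℝ≥0∞ := A * ENNReal.ofReal R ^ (p * θ) * τ ^ p with hL₂
  have hpθ : 0 ≤ p * θ := by positivity
  have hκp : κ ^ p ≠ ∞ := ENNReal.rpow_ne_top_of_nonneg hp0.le hκt
  have hRp : (A : ℝ≥0∞) * ENNReal.ofReal R ^ (p * θ) ≠ ∞ :=
    ENNReal.mul_ne_top ENNReal.coe_ne_top
      (ENNReal.rpow_ne_top_of_nonneg hpθ ENNReal.ofReal_ne_top)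
  have hL₀t : L₀ ≠ ∞ := ENNReal.mul_ne_top (ENNReal.mul_ne_top ENNReal.coe_ne_top
    (ENNReal.rpow_ne_top_of_nonneg hpθ ENNReal.ofNat_ne_top)) hκp
  have hL₁t : L₁ ≠ ∞ := ENNReal.mul_ne_top hRp hκp
  have hL₂t : L₂ ≠ ∞ := ENNReal.mul_ne_top hRp
    (ENNReal.rpow_ne_top_of_nonneg hp0.le ENNReal.ofReal_ne_top)
  obtain ⟨C, hC⟩ : ∃ C : ℝ≥0, (C : ℝ≥0∞) = 1 + 2 ^ p * L₀ + L₀ ^ (1 / (p - 1)) + L₁ + L₂ := by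
    refine ⟨_, ENNReal.coe_toNNReal ?_⟩
    simp only [ne_eq, ENNReal.add_eq_top, not_or]
    exact ⟨⟨⟨⟨ENNReal.one_ne_top, ENNReal.mul_ne_top
      (ENNReal.rpow_ne_top_of_nonneg hp0.le ENNReal.ofNat_ne_top) hL₀t⟩,
      ENNReal.rpow_ne_top_of_nonneg (by positivity) hL₀t⟩, hL₁t⟩, hL₂t⟩
  have hC1 : 1 ≤ C := by
    have : (1 : ℝ≥0∞) ≤ C := by
      rw [hC, add_assoc, add_assoc, add_assoc]
      exact le_self_add
    exact_mod_cast this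
  have hCL₀ : 2 ^ p * L₀ ≤ C := by
    rw [hC, add_comm 1, add_assoc, add_assoc, add_assoc]
    exact le_self_add
  have hCL₀' : L₀ ^ (1 / (p - 1)) ≤ C := by
    rw [hC, add_comm (1 + _), add_assoc, add_assoc]
    exact le_self_add
  have hCL₁ : L₁ ≤ C := by
    rw [hC, add_comm _ L₁, add_assoc]
    exact le_self_add
  have hCL₂ : L₂ ≤ C := by
    rw [hC]
    exact le_add_self
  obtain ⟨D, E, hDE, habs⟩ := exists_quasi_triangle_absorb hσ hC1
  set K₀ : ℝ≥0∞ := D * (2 * C * (2 ^ σ * C + E * ((2 * (2 ^ d : ℝ≥0)) ^ σ * C + C))) + E * C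
    with hK₀
  have hK₀t : K₀ ≠ ∞ := by
    have h2 : (2 : ℝ≥0∞) ^ σ ≠ ∞ := ENNReal.rpow_ne_top_of_nonneg hσ0.le ENNReal.ofNat_ne_top
    have h3 : (2 * (2 ^ d : ℝ≥0) : ℝ≥0∞) ^ σ ≠ ∞ :=
      ENNReal.rpow_ne_top_of_nonneg hσ0.le (ENNReal.mul_ne_top ENNReal.ofNat_ne_top
        ENNReal.coe_ne_top)
    finiteness
  set t := ENNReal.ofReal ((3 * ((d : ℝ) + 1)) ^ d) with ht
  refine ⟨K₀ * (2 * (C * t ^ α)) ^ σ * C, ?_, ?_⟩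
  · have h2 : t ^ α ≠ ∞ := ENNReal.rpow_ne_top_of_nonneg hα ENNReal.ofReal_ne_top
    have h3 : (2 * (C * t ^ α)) ^ σ ≠ ∞ := ENNReal.rpow_ne_top_of_nonneg hσ0.le
      (ENNReal.mul_ne_top ENNReal.ofNat_ne_top (ENNReal.mul_ne_top ENNReal.coe_ne_top h2))
    exact ENNReal.mul_ne_top (ENNReal.mul_ne_top hK₀t h3) ENNReal.coe_ne_top
  intro f M hf hM hfM x r hr
  have hr0 : 0 < r := (hρ x).trans_le hr
  have hg := goodAtoms_cubeIndex hr0 hp hθ hα hpos hm hl hA hf hM hfM hC1 hCL₀ hCL₀'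
  set Φ := ENNReal.ofReal (1 + r / ρ x) with hΦ
  have hΦ1 : 1 ≤ Φ := by
    rw [hΦ, ENNReal.one_le_ofReal]
    have := (hρ x).le
    have : 0 ≤ r / ρ x := by positivity
    linarith
  set a := 2 * (ENNReal.ofReal M * ((κ * ENNReal.ofReal (r ^ d)) ^ α * C)) with ha
  set W := weightMeasure w
  set A₀ : Set (Rd d) := {z | ∃ y ∈ ball x r, cubeIndex d r 0 y = cubeIndex d r 0 z} with hA₀
  have hatom : ∀ z ∈ A₀, atom (cubeIndex d r) 0 z ⊆ ball x (R * r) := by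
    rintro z ⟨y, hy, hyz⟩
    refine (atom_cubeIndex_subset_ball hr0 0 hyz).trans (ball_subset_ball' ?_)
    have := mem_ball.1 hy
    rw [hR, pow_zero, div_one]
    linarith
  have hA₀B : A₀ ⊆ ball x (R * r) := fun z hz => hatom z hz (self_mem_atom _ 0 z)
  have hBA₀ : ball x r ⊆ A₀ := fun z hz => ⟨z, hz, rfl⟩
  have hvolB : volume (ball x r) = ENNReal.ofReal (r ^ d) * volume (ball (0 : Rd d) 1) := by
    rw [Measure.addHaar_ball_of_pos _ _ hr0, finrank_euclideanSpace_fin]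
  have hvolB1 : volume (ball x (R * r)) = τ * volume (ball x r) := by
    rw [hvolB, Measure.addHaar_ball_of_pos _ _ (by positivity), finrank_euclideanSpace_fin,
      mul_pow, ENNReal.ofReal_mul (by positivity), hτ, mul_assoc]
  have hτκ : τ * volume (ball (0 : Rd d) 1) ≤ κ := by
    rw [hκ, ballCubeRatio]
    gcongr
    refine ENNReal.ofReal_le_ofReal ?_
    have : (0 : ℝ) ≤ d := d.cast_nonneg
    gcongr
    linarith
  have hW0 : W (ball x (R * r)) ≤ C * Φ ^ (p * θ) * W (ball x r) := by
    refine (weightMeasure_ball_le hp hθ hpos hm hA hr0 hR1 measurableSet_ball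
      (ball_subset_ball (by nlinarith)) (measure_ball_pos _ _ hr0).ne' hvolB1).trans ?_
    gcongr
  have hWQ : ∀ z ∈ A₀, W (ball x (R * r)) ≤ C * Φ ^ (p * θ) * W (atom (cubeIndex d r) 0 z) := by
    intro z hz
    have hv : volume (ball x (R * r)) =
        τ * volume (ball (0 : Rd d) 1) * volume (atom (cubeIndex d r) 0 z) := by
      rw [hvolB1, hvolB, volume_atom_cubeIndex hr0, pow_zero, div_one]
      ring
    refine (weightMeasure_ball_le hp hθ hpos hm hA hr0 hR1
      (measurableSet_atom_cubeIndex r 0 z) (hatom z hz) (volume_atom_ne_zero hr0 0 z) hv).trans ?_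
    gcongr
    refine le_trans ?_ hCL₁
    rw [hL₁]
    gcongr
  have hab : a ≤ a * Φ ^ (p * θ) := le_mul_of_one_le_right' (ENNReal.one_le_rpow hΦ1
    (by positivity))
  have hlim : ∀ᵐ z ∂(weightMeasure fun x => w x ^ (-(1 / (p - 1)))), Filter.Tendsto
      (fun N => atomAvg volume (cubeIndex d r) f N z) Filter.atTop (nhds (f z)) :=
    (withDensity_absolutelyContinuous _ _).ae_le (ae_tendsto_atomAvg_cubeIndex hr0 hf)
  have key := hg.setLIntegral_rpow_le hσ hDE habs (A := A₀) (b := a * Φ ^ (p * θ))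
    (fun z hz y hy => by
      obtain ⟨u, hu, huz⟩ := hz
      exact ⟨u, hu, huz.trans (Eq.symm hy)⟩) hab ?_ (goodCube_eventually hρ) hlim
  · have hb : a * Φ ^ (p * θ) = 2 * (C * t ^ α) * (ENNReal.ofReal M * volume (ball x r) ^ α) *
        Φ ^ (p * θ) := by
      rw [ha, hκ, ballCubeRatio, hvolB, mul_assoc (ENNReal.ofReal ((3 * ((d : ℝ) + 1)) ^ d)),
        mul_comm (volume _) (ENNReal.ofReal (r ^ d)),
        ENNReal.mul_rpow_of_nonneg (ENNReal.ofReal ((3 * ((d : ℝ) + 1)) ^ d)) _ hα]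
      ring
    calc _ ≤ _ := lintegral_mono_set hBA₀
      _ ≤ _ := key
      _ ≤ K₀ * (a * Φ ^ (p * θ)) ^ σ * (C * Φ ^ (p * θ) * W (ball x r)) := by
          gcongr
          exact (measure_mono hA₀B).trans hW0
      _ = _ := by
          rw [hb, ENNReal.mul_rpow_of_nonneg _ _ hσ0.le, ENNReal.mul_rpow_of_nonneg _ _ hσ0.le,
            ENNReal.rpow_add_of_nonneg _ _ (by positivity) (by positivity),
            ENNReal.rpow_mul Φ (p * θ) σ]
          ring
  · intro z hz _
    have hRr : 0 < R * r := by positivity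
    calc _ ≤ ∫⁻ y in ball x (R * r), ‖f y‖ₑ := lintegral_mono_set (hatom z hz)
      _ ≤ _ := hfM.lintegral_le hf hpos hl hM.le hRr (by nlinarith)
      _ ≤ ENNReal.ofReal M * ((κ * ENNReal.ofReal (r ^ d)) ^ α *
            (C * Φ ^ (p * θ) * W (atom (cubeIndex d r) 0 z))) := by
          gcongr _ * (?_ ^ α * ?_)
          · rw [hvolB1, hvolB, mul_comm (ENNReal.ofReal (r ^ d)), ← mul_assoc]
            gcongr
          · exact hWQ z hz
      _ = ENNReal.ofReal M * ((κ * ENNReal.ofReal (r ^ d)) ^ α * C) * Φ ^ (p * θ) *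
            W (atom (cubeIndex d r) 0 z) := by ring
      _ ≤ _ := by
          gcongr
          rw [ha, two_mul]
          exact le_self_add

end SelfImprovement

section Conclusion

variable {d : ℕ}

theorem setLIntegral_weightMeasure {w : Rd d → ℝ} (hm : Measurable w)
    {B : Set (Rd d)} (hB : MeasurableSet B) (g : Rd d → ℝ≥0∞) :
    ∫⁻ y in B, g y ∂(weightMeasure w) = ∫⁻ y in B, ENNReal.ofReal (w y) * g y :=
  setLIntegral_withDensity_eq_setLIntegral_mul_non_measurable volume (by fun_prop) g hB
    (Filter.Eventually.of_forall fun _ => ENNReal.ofReal_lt_top)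

theorem setLIntegral_div_rpow_weightMeasure {w f : Rd d → ℝ} {ν : ℝ} (hw : ∀ x, 0 < w x)
    (hm : Measurable w) (hν : 0 < ν) {B : Set (Rd d)} (hB : MeasurableSet B) :
    ∫⁻ y in B, ‖f y / w y‖ₑ ^ ν ∂(weightMeasure w) =
      ∫⁻ y in B, ENNReal.ofReal (|f y| ^ ν * w y ^ (1 - ν)) := by
  rw [setLIntegral_weightMeasure hm hB]
  refine lintegral_congr fun y => ?_
  have hy := hw y
  rw [Real.enorm_eq_ofReal_abs, ENNReal.ofReal_rpow_of_nonneg (abs_nonneg _) hν.le,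
    ← ENNReal.ofReal_mul hy.le, abs_div, abs_of_pos hy, Real.div_rpow (abs_nonneg _) hy.le,
    Real.rpow_sub hy, Real.rpow_one]
  congr 1
  ring

theorem setLIntegral_rpow_weightMeasure_dual {w f : Rd d → ℝ} {p : ℝ} (hp : 1 < p)
    (hw : ∀ x, 0 < w x) (hm : Measurable w) {B : Set (Rd d)} (hB : MeasurableSet B) :
    ∫⁻ y in B, ‖f y‖ₑ ^ (p / (p - 1)) ∂(weightMeasure fun x => w x ^ (-(1 / (p - 1)))) =
      ∫⁻ y in B, ENNReal.ofReal (|f y| ^ (p / (p - 1)) * w y ^ (1 - p / (p - 1))) := by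
  rw [setLIntegral_weightMeasure (by fun_prop) hB]
  refine lintegral_congr fun y => ?_
  have hp1 : 0 < p - 1 := by linarith
  have hy := (hw y).le
  rw [Real.enorm_eq_ofReal_abs, ENNReal.ofReal_rpow_of_nonneg (abs_nonneg _) (by positivity),
    ← ENNReal.ofReal_mul (by positivity), mul_comm]
  congr 3
  field_simp
  ring

theorem lintegral_rpow_mul_le {w f : Rd d → ℝ} {ν σ : ℝ} (hw : ∀ x, 0 < w x)
    (hm : Measurable w) (hf : AEStronglyMeasurable f volume) (hν : 0 < ν) (hνσ : ν ≤ σ)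
    {B : Set (Rd d)} (hB : MeasurableSet B) :
    (∫⁻ y in B, ENNReal.ofReal (|f y| ^ ν * w y ^ (1 - ν))) ^ (1 / ν) ≤
      (∫⁻ y in B, ENNReal.ofReal (|f y| ^ σ * w y ^ (1 - σ))) ^ (1 / σ) *
        weightMeasure w B ^ (1 / ν - 1 / σ) := by
  have hfw : AEStronglyMeasurable (fun y => f y / w y) ((weightMeasure w).restrict B) :=
    (((hf.mono_ac (withDensity_absolutelyContinuous _ _)).restrict.aemeasurable).div
      hm.aemeasurable).aestronglyMeasurable
  have h := eLpNorm'_le_eLpNorm'_mul_rpow_measure_univ hν hνσ hfw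
  rwa [eLpNorm'_eq_lintegral_enorm, eLpNorm'_eq_lintegral_enorm,
    setLIntegral_div_rpow_weightMeasure hw hm hν hB,
    setLIntegral_div_rpow_weightMeasure hw hm (hν.trans_le hνσ) hB,
    Measure.restrict_apply_univ] at h

theorem MemAp.exists_ballInt_rpow_le {p θ α ν : ℝ} {ρ w : Rd d → ℝ} (hw : MemAp d p θ ρ w)
    (hp : 1 < p) (hθ : 0 < θ) (hα : 0 ≤ α) (hν : 1 < ν) (hν' : ν ≤ p / (p - 1))
    (hρ : ∀ x, 0 < ρ x) :
    ∃ γ > (0 : ℝ), ∃ C > 0, ∀ (f : Rd d → ℝ) (M : ℝ), LocallyIntegrable f volume → 0 < M →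
      BMOBound d α ρ w f M → ∀ (x : Rd d) (r : ℝ), ρ x ≤ r →
        ballVol d x r ^ (-α) *
          ((ballInt d x r w)⁻¹ *
            ballInt d x r (fun y => |f y| ^ ν * w y ^ (1 - ν))) ^ (1 / ν) ≤
          C * (1 + r / ρ x) ^ γ * M := by
  obtain ⟨K, hK, h⟩ := hw.exists_lintegral_rpow_le hp hθ hα hρ
  obtain ⟨hpos, hm, hl, -⟩ := hw
  have hp1 : 0 < p - 1 := by linarith
  have hν0 : 0 < ν := by linarith
  set σ := p / (p - 1) with hσ
  have hσ0 : 0 < σ := by linarith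
  have hp0 : 0 < p := by linarith
  refine ⟨(p * θ * σ + p * θ) / σ, by positivity, (K ^ (1 / σ)).toReal + 1, by positivity, ?_⟩
  intro f M hf hM hfM x r hr
  have hr0 : 0 < r := (hρ x).trans_le hr
  have hΦ : 0 < 1 + r / ρ x := by
    have := hρ x
    positivity
  have hv := ballVol_pos x hr0
  have hI := ballInt_pos hpos hm hl x hr0
  set γ := (p * θ * σ + p * θ) / σ with hγ
  set J := ∫⁻ y in ball x r, ENNReal.ofReal (|f y| ^ ν * w y ^ (1 - ν)) with hJ
  have hJr : ballInt d x r (fun y => |f y| ^ ν * w y ^ (1 - ν)) = J.toReal := by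
    refine integral_eq_lintegral_of_nonneg_ae (Filter.Eventually.of_forall fun y => ?_) ?_
    · have := hpos y
      simp only [Pi.zero_apply]
      positivity
    · have hfm := hf.aestronglyMeasurable.aemeasurable
      exact AEMeasurable.aestronglyMeasurable (AEMeasurable.restrict (by fun_prop))
  have hJle : J ^ (1 / ν) ≤ ENNReal.ofReal ((K ^ (1 / σ)).toReal * M * ballVol d x r ^ α *
      (1 + r / ρ x) ^ γ * ballInt d x r w ^ (1 / ν)) := by
    have hWeq := weightMeasure_ball hpos hl x r
    have hW0 : weightMeasure w (ball x r) ≠ 0 :=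
      weightMeasure_ne_zero hpos hm (measure_ball_pos _ _ hr0).ne'
    have hWt : weightMeasure w (ball x r) ≠ ∞ := by
      rw [hWeq]
      exact ENNReal.ofReal_ne_top
    calc J ^ (1 / ν)
        ≤ _ := lintegral_rpow_mul_le hpos hm hf.aestronglyMeasurable hν0 hν' measurableSet_ball
      _ ≤ (K * (ENNReal.ofReal M * volume (ball x r) ^ α) ^ σ *
            ENNReal.ofReal (1 + r / ρ x) ^ (p * θ * σ + p * θ) *
              weightMeasure w (ball x r)) ^ (1 / σ) *
            weightMeasure w (ball x r) ^ (1 / ν - 1 / σ) := by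
          rw [← setLIntegral_rpow_weightMeasure_dual hp hpos hm measurableSet_ball]
          gcongr
          exact h f M hf hM hfM x r hr
      _ = K ^ (1 / σ) * (ENNReal.ofReal M * volume (ball x r) ^ α) *
            ENNReal.ofReal (1 + r / ρ x) ^ γ *
              (weightMeasure w (ball x r) ^ (1 / σ) *
                weightMeasure w (ball x r) ^ (1 / ν - 1 / σ)) := by
          have h1 : 0 ≤ 1 / σ := by positivity
          rw [ENNReal.mul_rpow_of_nonneg _ _ h1, ENNReal.mul_rpow_of_nonneg _ _ h1,
            ENNReal.mul_rpow_of_nonneg _ _ h1, ← ENNReal.rpow_mul, ← ENNReal.rpow_mul,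
            mul_one_div_cancel hσ0.ne', ENNReal.rpow_one, mul_one_div, mul_assoc]
      _ = _ := by
          rw [← ENNReal.rpow_add _ _ hW0 hWt, add_sub_cancel, hWeq, ← ofReal_ballVol,
            ENNReal.ofReal_rpow_of_pos hv, ENNReal.ofReal_rpow_of_pos hΦ,
            ENNReal.ofReal_rpow_of_pos hI, ENNReal.ofReal_mul (by positivity),
            ENNReal.ofReal_mul (by positivity), ENNReal.ofReal_mul (by positivity),
            ENNReal.ofReal_mul (by positivity), ENNReal.ofReal_toReal
              (ENNReal.rpow_ne_top_of_nonneg (by positivity) hK)]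
          ring
  have hreal := ENNReal.toReal_mono ENNReal.ofReal_ne_top hJle
  rw [← ENNReal.toReal_rpow, ENNReal.toReal_ofReal (by positivity)] at hreal
  rw [hJr, Real.mul_rpow (by positivity) ENNReal.toReal_nonneg, Real.inv_rpow hI.le,
    Real.rpow_neg hv.le]
  calc _ ≤ (ballVol d x r ^ α)⁻¹ * ((ballInt d x r w ^ (1 / ν))⁻¹ *
        ((K ^ (1 / σ)).toReal * M * ballVol d x r ^ α * (1 + r / ρ x) ^ γ *
          ballInt d x r w ^ (1 / ν))) := by gcongr
    _ = (K ^ (1 / σ)).toReal * (1 + r / ρ x) ^ γ * M := by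
        have h1 : 0 < ballVol d x r ^ α := by positivity
        have h2 : 0 < ballInt d x r w ^ (1 / ν) := by positivity
        field_simp
    _ ≤ _ := by
        gcongr
        linarith

end Conclusion

/-- Weighted self-improving inequality for `BMO^α_{L,w}` on super-critical balls:
`|B|^{-α} (w(B)^{-1} ∫_B |f|^ν w^{1-ν})^{1/ν} ≤ C (1 + r/ρ(x))^γ ‖f‖` for `r ≥ ρ(x)`. -/
theorem statement4 (d : ℕ) (hd : 3 ≤ d) (q : ℝ) (hq : (d : ℝ) / 2 < q)
    (V : Rd d → ℝ) (hV : IsRH d q V)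
    (ρ : Rd d → ℝ) (hρ : ρ = criticalRadius d V) (hρpos : ∀ x, 0 < ρ x)
    (p θ α ν : ℝ) (hp : 1 < p) (hθ : 0 < θ) (hα : 0 ≤ α) (hα1 : α < 1)
    (hν : 1 < ν) (hν' : ν ≤ p / (p - 1))
    (w : Rd d → ℝ) (hw : MemAp d p θ ρ w) :
    ∃ γ > (0:ℝ), ∃ C > 0, ∀ f : Rd d → ℝ, MemBMO d α ρ w f →
      ∀ (x : Rd d) (r : ℝ), ρ x ≤ r →
        ballVol d x r ^ (-α) *
          ((ballInt d x r w)⁻¹ *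
            ballInt d x r (fun y => |f y| ^ ν * w y ^ (1 - ν))) ^ (1/ν) ≤
          C * (1 + r / ρ x) ^ γ * bmoNorm d α ρ w f := by
  obtain ⟨γ, hγ, C, hC, h⟩ := hw.exists_ballInt_rpow_le hp hθ hα hν hν' hρpos
  refine ⟨γ, hγ, C, hC, fun f ⟨hf, M₀, hM₀, hfM₀⟩ x r hr => ?_⟩
  have hΦ : 0 < C * (1 + r / ρ x) ^ γ := by
    have h1 := hρpos x
    have h2 : 0 < r := h1.trans_le hr
    positivity
  rw [← div_le_iff₀' hΦ]
  refine le_csInf ⟨M₀, hM₀, hfM₀⟩ fun M ⟨hM, hfM⟩ => ?_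
  rw [div_le_iff₀' hΦ]
  exact h f M hf hM hfM x r hr
end
end

section
/- Let F : (0,∞) → ℝ be differentiable on (0,∞) with derivative F' Lebesgue integrable on (0,∞). Then the short variation satisfies SV(F) ≤ ∫₀^∞ |F'(t)| dt. -/
open MeasureTheory Filter

noncomputable section

/-- The oscillation operator `O(F,(t_j)_{j∈ℤ})`, valued in `ℝ≥0∞`:
`O(F,(t_j)) = (∑_{j∈ℤ} sup_{t_j ≤ ε < ε' ≤ t_{j+1}} |F(ε) - F(ε')|²)^{1/2}`. -/
noncomputable def oscOp (F : ℝ → ℝ) (t : ℤ → ℝ) : ENNReal :=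
  (∑' j : ℤ, ⨆ (ε : ℝ) (ε' : ℝ) (_ : t j ≤ ε) (_ : ε < ε') (_ : ε' ≤ t (j+1)),
      (ENNReal.ofReal |F ε - F ε'|) ^ 2) ^ (1/2 : ℝ)

/-- The `σ`-variation of `F` over a set `I ⊆ (0,∞)`, valued in `ℝ≥0∞`:
the supremum over `n ∈ ℕ` and finite decreasing sequences
`t_{n-1} < … < t_0` with all `t_j ∈ I` of `(∑_{j=0}^{n-2} |F(t_{j+1}) - F(t_j)|^σ)^{1/σ}`. -/
noncomputable def varOpOn (σ : ℝ) (F : ℝ → ℝ) (I : Set ℝ) : ENNReal :=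
  ⨆ (n : ℕ) (t : ℕ → ℝ) (_ : ∀ j, j < n → t j ∈ I)
    (_ : ∀ i j, i < j → j < n → t j < t i),
    (∑ j ∈ Finset.range (n - 1), (ENNReal.ofReal |F (t (j+1)) - F (t j)|) ^ σ) ^ (1/σ)

/-- The `σ`-variation operator `V_σ(F)`. -/
noncomputable def varOp (σ : ℝ) (F : ℝ → ℝ) : ENNReal := varOpOn σ F (Set.Ioi 0)

/-- The dyadic block variation `V_k(F)` over `(2^{-k}, 2^{-k+1}]` (with exponent 2). -/
noncomputable def dyadicVar (k : ℤ) (F : ℝ → ℝ) : ENNReal :=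
  varOpOn 2 F (Set.Ioc ((2:ℝ) ^ (-k)) ((2:ℝ) ^ (-k+1)))

/-- The short variation operator `SV(F) = (∑_{k∈ℤ} V_k(F)²)^{1/2}`. -/
noncomputable def shortVarOp (F : ℝ → ℝ) : ENNReal :=
  (∑' k : ℤ, (dyadicVar k F) ^ 2) ^ (1/2 : ℝ)

theorem ENNReal.tsum_sq_le_sq_tsum {ι : Type*} (a : ι → ENNReal) :
    ∑' i, a i ^ 2 ≤ (∑' i, a i) ^ 2 := by
  rw [sq (∑' i, a i), ← ENNReal.tsum_mul_right]
  refine ENNReal.tsum_le_tsum fun i => ?_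
  rw [sq]
  gcongr
  exact ENNReal.le_tsum i

theorem ENNReal.sum_sq_le_sq_sum {ι : Type*} (s : Finset ι) (a : ι → ENNReal) :
    ∑ i ∈ s, a i ^ 2 ≤ (∑ i ∈ s, a i) ^ 2 := by
  rw [← Finset.tsum_subtype, ← Finset.tsum_subtype]
  exact ENNReal.tsum_sq_le_sq_tsum fun i : s => a i

theorem ENNReal.rpow_half_le_of_le_sq {x y : ENNReal} (h : x ≤ y ^ 2) :
    x ^ (1 / 2 : ℝ) ≤ y := by
  rw [one_div, ENNReal.rpow_inv_le_iff two_pos]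
  exact_mod_cast h

theorem ofReal_abs_sub_le_lintegral_enorm_deriv {F F' : ℝ → ℝ} {a b : ℝ} (hab : a ≤ b)
    (hderiv : ∀ s ∈ Set.Icc a b, HasDerivAt F (F' s) s)
    (hint : IntegrableOn F' (Set.Ioc a b) volume) :
    ENNReal.ofReal |F b - F a| ≤ ∫⁻ s in Set.Ioc a b, ‖F' s‖ₑ := by
  have h := intervalIntegral.integral_eq_sub_of_hasDerivAt
    (fun s hs => hderiv s (by rwa [Set.uIcc_of_le hab] at hs))
    ((intervalIntegrable_iff_integrableOn_Ioc_of_le hab).2 hint)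
  rw [← h, intervalIntegral.integral_of_le hab, ← Real.enorm_eq_ofReal_abs]
  exact enorm_integral_le_lintegral_enorm _

theorem varOpOn_two_Ioc_le_lintegral_enorm_deriv {F F' : ℝ → ℝ} {a b : ℝ}
    (hderiv : ∀ s ∈ Set.Ioc a b, HasDerivAt F (F' s) s)
    (hint : IntegrableOn F' (Set.Ioc a b) volume) :
    varOpOn 2 F (Set.Ioc a b) ≤ ∫⁻ s in Set.Ioc a b, ‖F' s‖ₑ := by
  refine iSup_le fun n => iSup_le fun t => iSup_le fun ht => iSup_le fun hlt => ?_
  simp only [ENNReal.rpow_two]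
  refine ENNReal.rpow_half_le_of_le_sq ((ENNReal.sum_sq_le_sq_sum _ _).trans ?_)
  gcongr
  have hsub : ∀ j ∈ Finset.range (n - 1), Set.Ioc (t (j + 1)) (t j) ⊆ Set.Ioc a b := by
    intro j hj
    rw [Finset.mem_range] at hj
    exact Set.Ioc_subset_Ioc (ht (j + 1) (by omega)).1.le (ht j (by omega)).2
  have hstep : ∀ j ∈ Finset.range (n - 1), ENNReal.ofReal |F (t (j + 1)) - F (t j)| ≤
      ∫⁻ s in Set.Ioc (t (j + 1)) (t j), ‖F' s‖ₑ := by
    intro j hj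
    have hj' := Finset.mem_range.1 hj
    rw [abs_sub_comm]
    refine ofReal_abs_sub_le_lintegral_enorm_deriv (hlt j (j + 1) (by omega) (by omega)).le
      (fun s hs => hderiv s ⟨(ht (j + 1) (by omega)).1.trans_le hs.1,
        hs.2.trans (ht j (by omega)).2⟩) (hint.mono_set (hsub j hj))
  have hdisj : (Finset.range (n - 1) : Set ℕ).PairwiseDisjoint
      fun j => Set.Ioc (t (j + 1)) (t j) := by
    have key : ∀ i j, i < j → j < n - 1 →
        Disjoint (Set.Ioc (t (i + 1)) (t i)) (Set.Ioc (t (j + 1)) (t j)) := by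
      intro i j hij hj
      have hle : t j ≤ t (i + 1) := by
        rcases (Nat.succ_le_of_lt hij).eq_or_lt with h | h
        · exact (congrArg t h).ge
        · exact (hlt _ _ h (by omega)).le
      exact Set.disjoint_left.2 fun x hx hx' => (hx.1.trans_le hx'.2).not_ge hle
    intro i hi j hj hij
    simp only [Finset.coe_range, Set.mem_Iio] at hi hj
    rcases hij.lt_or_gt with h | h
    · exact key i j h hj
    · exact (key j i h hi).symm
  calc _ ≤ ∑ j ∈ Finset.range (n - 1), ∫⁻ s in Set.Ioc (t (j + 1)) (t j), ‖F' s‖ₑ :=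
        Finset.sum_le_sum hstep
    _ = ∫⁻ s in ⋃ j ∈ Finset.range (n - 1), Set.Ioc (t (j + 1)) (t j), ‖F' s‖ₑ :=
        (lintegral_biUnion_finset hdisj (fun _ _ => measurableSet_Ioc) _).symm
    _ ≤ _ := lintegral_mono_set (Set.iUnion₂_subset hsub)

theorem pairwise_disjoint_Ioc_two_zpow :
    Pairwise (Function.onFun Disjoint
      fun k : ℤ => Set.Ioc ((2 : ℝ) ^ (-k)) ((2 : ℝ) ^ (-k + 1))) := by
  have hanti : Antitone fun k : ℤ => (2 : ℝ) ^ (-k + 1) := fun i j hij =>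
    zpow_le_zpow_right₀ one_le_two (by omega)
  convert hanti.pairwise_disjoint_on_Ioc_succ using 5 with k
  rw [Order.succ_eq_add_one]
  ring

/-- If `F` is differentiable on `(0,∞)` with integrable derivative, then its short
variation is bounded by `∫₀^∞ |F'(t)| dt`. -/
theorem statement6 (F F' : ℝ → ℝ) (hderiv : ∀ s : ℝ, 0 < s → HasDerivAt F (F' s) s)
    (hint : IntegrableOn F' (Set.Ioi 0) volume) :
    shortVarOp F ≤ ENNReal.ofReal (∫ s in Set.Ioi (0:ℝ), |F' s|) := by
  have hsub : ∀ k : ℤ, Set.Ioc ((2 : ℝ) ^ (-k)) ((2 : ℝ) ^ (-k + 1)) ⊆ Set.Ioi 0 :=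
    fun k s hs => (zpow_pos two_pos (-k)).trans hs.1
  have hnorm : ENNReal.ofReal (∫ s in Set.Ioi (0:ℝ), |F' s|) =
      ∫⁻ s in Set.Ioi (0:ℝ), ‖F' s‖ₑ := ofReal_integral_norm_eq_lintegral_enorm hint
  rw [hnorm]
  refine ENNReal.rpow_half_le_of_le_sq ((ENNReal.tsum_sq_le_sq_tsum _).trans ?_)
  gcongr
  calc ∑' k, dyadicVar k F
      ≤ ∑' k : ℤ, ∫⁻ s in Set.Ioc ((2 : ℝ) ^ (-k)) ((2 : ℝ) ^ (-k + 1)), ‖F' s‖ₑ :=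
        ENNReal.tsum_le_tsum fun k => varOpOn_two_Ioc_le_lintegral_enorm_deriv
          (fun s hs => hderiv s (hsub k hs)) (hint.mono_set (hsub k))
    _ = ∫⁻ s in ⋃ k : ℤ, Set.Ioc ((2 : ℝ) ^ (-k)) ((2 : ℝ) ^ (-k + 1)), ‖F' s‖ₑ :=
        (lintegral_iUnion (fun _ => measurableSet_Ioc) pairwise_disjoint_Ioc_two_zpow _).symm
    _ ≤ _ := lintegral_mono_set (Set.iUnion_subset hsub)
end
end

section
/- Let d ≥ 1 and k ∈ ℕ. There exists a constant C > 0 such that for every z ∈ ℝ^d with z ≠ 0, ∫₀^∞ | d/dt ( t^k (∂_t^k W_t)(z) ) | dt ≤ C |z|^{−d}, where ∂_t^k denotes the k-th derivative in t of the map t ↦ W_t(z). Consequently, for any strictly increasing sequence (t_j)_{j∈ℤ} of positive reals with t_j → 0 as j → −∞ and t_j → +∞ as j → +∞, the oscillation of the function t ↦ t^k (∂_t^k W_t)(z) associated with (t_j) is at most C|z|^{−d}. -/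
open MeasureTheory Filter

noncomputable section

/-- The classical heat kernel `W_t(z) = (4πt)^{-d/2} e^{-|z|²/(4t)}` on `ℝ^d`. -/
noncomputable def heatKernel (d : ℕ) (t : ℝ) (z : EuclideanSpace ℝ (Fin d)) : ℝ :=
  (4 * Real.pi * t) ^ (-(d : ℝ)/2) * Real.exp (-‖z‖ ^ 2 / (4 * t))

open Polynomial in
/-- The profile `t^{-p} e^{-a/t} Q(a/t)`, for a real polynomial `Q`. -/
def heatProfile (p : ℝ) (Q : ℝ[X]) (a t : ℝ) : ℝ :=
  t ^ (-p) * Real.exp (-a / t) * Q.eval (a / t)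

open Polynomial in
/-- The operator on polynomials induced by `t ∂_t` on the profiles `heatProfile p Q a`. -/
def eulerOp (p : ℝ) (Q : ℝ[X]) : ℝ[X] :=
  (X - C p) * Q - X * derivative Q

open Polynomial in
/-- The polynomial whose profile is `t^k ∂_t^k` of `t^{-p} e^{-a/t}`. -/
def heatPoly (p : ℝ) : ℕ → ℝ[X]
  | 0 => 1
  | k + 1 => eulerOp p (heatPoly p k) - C (k : ℝ) * heatPoly p k

open Polynomial in
lemma hasDerivAt_heatProfile (p : ℝ) (Q : ℝ[X]) (a : ℝ) {t : ℝ} (ht : 0 < t) :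
    HasDerivAt (heatProfile p Q a) (t⁻¹ * heatProfile p (eulerOp p Q) a t) t := by
  have h1 : HasDerivAt (fun s : ℝ => s ^ (-p)) (-p * t ^ (-p - 1)) t :=
    Real.hasDerivAt_rpow_const (Or.inl ht.ne')
  have h2 : ∀ b : ℝ, HasDerivAt (fun s : ℝ => b / s) (-b / t ^ 2) t := fun b => by
    simpa [div_eq_mul_inv] using (hasDerivAt_inv ht.ne').const_mul b
  have h3 := (Q.hasDerivAt (a / t)).comp t (h2 a)
  refine ((h1.mul (h2 (-a)).exp).mul h3).congr_deriv ?_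
  rw [Real.rpow_sub_one ht.ne']
  simp only [heatProfile, eulerOp, eval_sub, eval_mul, eval_X, eval_C, Pi.mul_apply,
    Function.comp_apply]
  field_simp
  ring

lemma iterate_deriv_heatKernel {d : ℕ} (z : EuclideanSpace ℝ (Fin d)) (k : ℕ) {t : ℝ}
    (ht : 0 < t) :
    (deriv^[k] fun u => heatKernel d u z) t =
      (4 * Real.pi) ^ (-(d : ℝ) / 2) * ((t ^ k)⁻¹ *
        heatProfile ((d : ℝ) / 2) (heatPoly ((d : ℝ) / 2) k) (‖z‖ ^ 2 / 4) t) := by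
  induction k generalizing t with
  | zero =>
    simp only [Function.iterate_zero, id, heatKernel, heatProfile, heatPoly, Polynomial.eval_one]
    rw [Real.mul_rpow (by positivity) ht.le]
    have : -‖z‖ ^ 2 / (4 * t) = -(‖z‖ ^ 2 / 4) / t := by field_simp
    rw [this, neg_div]
    ring
  | succ k ih =>
    rw [Function.iterate_succ_apply']
    have hev : (deriv^[k] fun u => heatKernel d u z) =ᶠ[nhds t] fun s =>
        (4 * Real.pi) ^ (-(d : ℝ) / 2) * ((s ^ k)⁻¹ *
          heatProfile ((d : ℝ) / 2) (heatPoly ((d : ℝ) / 2) k) (‖z‖ ^ 2 / 4) s) := by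
      filter_upwards [Ioi_mem_nhds ht] with s hs using ih hs
    rw [hev.deriv_eq]
    have hpow : HasDerivAt (fun s : ℝ => (s ^ k)⁻¹) (-(k : ℝ) * (t ^ (k + 1))⁻¹) t := by
      have := hasDerivAt_zpow (-(k : ℤ)) t (Or.inl ht.ne')
      simp only [zpow_neg, zpow_natCast, Int.cast_neg, Int.cast_natCast] at this
      refine this.congr_deriv ?_
      rw [show -(k : ℤ) - 1 = -((k + 1 : ℕ) : ℤ) by push_cast; ring, zpow_neg, zpow_natCast]
    refine ((hpow.mul (hasDerivAt_heatProfile _ _ _ ht)).const_mul _).deriv.trans ?_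
    simp only [heatProfile, heatPoly, Polynomial.eval_sub, Polynomial.eval_mul,
      Polynomial.eval_C]
    field_simp
    ring

open Polynomial in
lemma integrableOn_rpow_mul_exp_neg_mul_eval {p : ℝ} (hp : 0 < p) (Q : ℝ[X]) :
    IntegrableOn (fun u : ℝ => u ^ (p - 1) * Real.exp (-u) * Q.eval u) (Set.Ioi 0) := by
  induction Q using Polynomial.induction_on' with
  | add P Q hP hQ =>
    simp only [eval_add, mul_add]
    exact hP.add hQ
  | monomial n c =>
    have h := (Real.GammaIntegral_convergent (s := p + n) (by positivity)).const_mul c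
    refine IntegrableOn.congr_fun h (fun u hu => ?_) measurableSet_Ioi
    have hu : (0 : ℝ) < u := hu
    simp only [eval_monomial]
    rw [show p + n - 1 = p - 1 + n by ring, Real.rpow_add hu, Real.rpow_natCast]
    ring

open Polynomial in
lemma integrableOn_inv_mul_heatProfile_one {p : ℝ} (hp : 0 < p) (Q : ℝ[X]) :
    IntegrableOn (fun t => t⁻¹ * heatProfile p Q 1 t) (Set.Ioi 0) := by
  have h := (integrableOn_Ioi_comp_rpow_iff
    (fun u : ℝ => u ^ (p - 1) * Real.exp (-u) * Q.eval u) (p := -1) (by norm_num)).2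
    (integrableOn_rpow_mul_exp_neg_mul_eval hp Q)
  refine h.congr_fun (fun t ht => ?_) measurableSet_Ioi
  have ht : (0 : ℝ) < t := ht
  have e : t ^ (-1 - 1 : ℝ) * (t⁻¹) ^ (p - 1) = t⁻¹ * t ^ (-p) := by
    rw [Real.inv_rpow ht.le, ← Real.rpow_neg ht.le, ← Real.rpow_neg_one, ← Real.rpow_add ht,
      ← Real.rpow_add ht]
    congr 1
    ring
  simp only [heatProfile, smul_eq_mul, Real.rpow_neg_one, abs_neg, abs_one, one_mul, one_div,
    neg_div]
  rw [← mul_assoc, ← mul_assoc, e]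
  ring

open Polynomial in
lemma inv_mul_heatProfile_eq (p : ℝ) (Q : ℝ[X]) {a t : ℝ} (ha : 0 < a) (ht : 0 < t) :
    t⁻¹ * heatProfile p Q a t =
      a ^ (-p) * a⁻¹ * ((a⁻¹ * t)⁻¹ * heatProfile p Q 1 (a⁻¹ * t)) := by
  have h1 : (1 : ℝ) / (a⁻¹ * t) = a / t := by field_simp
  have h2 : (-1 : ℝ) / (a⁻¹ * t) = -a / t := by field_simp
  simp only [heatProfile, h1, h2]
  rw [Real.mul_rpow (by positivity) ht.le, Real.inv_rpow ha.le]
  have : a ^ (-p) ≠ 0 := by positivity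
  field_simp

open Polynomial in
lemma integrableOn_inv_mul_heatProfile {p : ℝ} (hp : 0 < p) (Q : ℝ[X]) {a : ℝ} (ha : 0 < a) :
    IntegrableOn (fun t => t⁻¹ * heatProfile p Q a t) (Set.Ioi 0) := by
  have h := (integrableOn_Ioi_comp_mul_left_iff (fun t => t⁻¹ * heatProfile p Q 1 t) 0
    (inv_pos.2 ha)).2 (by simpa using integrableOn_inv_mul_heatProfile_one hp Q)
  exact IntegrableOn.congr_fun (h.const_mul (a ^ (-p) * a⁻¹))
    (fun t ht => (inv_mul_heatProfile_eq p Q ha ht).symm) measurableSet_Ioi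

open Polynomial in
lemma integral_abs_inv_mul_heatProfile (p : ℝ) (Q : ℝ[X]) {a : ℝ} (ha : 0 < a) :
    ∫ t in Set.Ioi (0 : ℝ), |t⁻¹ * heatProfile p Q a t| =
      a ^ (-p) * ∫ t in Set.Ioi (0 : ℝ), |t⁻¹ * heatProfile p Q 1 t| := by
  have h := integral_comp_mul_left_Ioi (fun t => |t⁻¹ * heatProfile p Q 1 t|) 0 (inv_pos.2 ha)
  rw [mul_zero, inv_inv, smul_eq_mul] at h
  rw [setIntegral_congr_fun (g := fun t => a ^ (-p) * a⁻¹ *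
    |(a⁻¹ * t)⁻¹ * heatProfile p Q 1 (a⁻¹ * t)|) measurableSet_Ioi, integral_const_mul, h]
  · field_simp
  · intro t ht
    simp only
    rw [inv_mul_heatProfile_eq p Q ha ht, abs_mul, abs_of_pos (by positivity)]

/-- The oscillation of a function along a sequence is at most its total variation. -/
lemma oscOp_le_lintegral_deriv {F : ℝ → ℝ} (hF : ∀ t, 0 < t → DifferentiableAt ℝ F t)
    (hint : IntegrableOn (deriv F) (Set.Ioi 0)) {t : ℤ → ℝ} (hpos : ∀ j, 0 < t j)
    (hmono : StrictMono t) :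
    oscOp F t ≤ ∫⁻ s in Set.Ioi (0 : ℝ), ENNReal.ofReal |deriv F s| := by
  set S := ∫⁻ s in Set.Ioi (0 : ℝ), ENNReal.ofReal |deriv F s| with hS
  set I : ℤ → ENNReal := fun j =>
    ∫⁻ s in Set.Ioc (t j) (t (j + 1)), ENNReal.ofReal |deriv F s| with hI
  have hsum : ∑' j, I j ≤ S := by
    rw [hI, ← lintegral_iUnion (fun j => measurableSet_Ioc)]
    · refine lintegral_mono_set (Set.iUnion_subset fun j x hx => ?_)
      exact (hpos j).trans hx.1
    · simpa using hmono.monotone.pairwise_disjoint_on_Ioc_succ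
  have hterm : ∀ j, (⨆ (ε : ℝ) (ε' : ℝ) (_ : t j ≤ ε) (_ : ε < ε') (_ : ε' ≤ t (j+1)),
      (ENNReal.ofReal |F ε - F ε'|) ^ 2) ≤ I j ^ 2 := by
    intro j
    refine iSup_le fun ε => iSup_le fun ε' => iSup_le fun h1 => iSup_le fun h2 =>
      iSup_le fun h3 => ?_
    have hε : 0 < ε := (hpos j).trans_le h1
    have hftc : ∫ s in ε..ε', deriv F s = F ε' - F ε := by
      refine intervalIntegral.integral_deriv_eq_sub (fun x hx => ?_) ?_
      · rw [Set.uIcc_of_le h2.le] at hx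
        exact hF x (hε.trans_le hx.1)
      · rw [intervalIntegrable_iff_integrableOn_Ioc_of_le h2.le]
        exact hint.mono_set fun x hx => hε.trans hx.1
    gcongr
    rw [abs_sub_comm, ← hftc, intervalIntegral.integral_of_le h2.le, ← Real.enorm_eq_ofReal_abs]
    refine (enorm_integral_le_lintegral_enorm _).trans ?_
    simp only [Real.enorm_eq_ofReal_abs, hI]
    exact lintegral_mono_set (Set.Ioc_subset_Ioc h1 h3)
  have hsq : (∑' j, I j ^ 2) ≤ S ^ 2 := by
    calc ∑' j, I j ^ 2 ≤ ∑' j, I j * S := by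
          refine ENNReal.tsum_le_tsum fun j => ?_
          rw [sq]
          gcongr
          exact (ENNReal.le_tsum j).trans hsum
      _ = (∑' j, I j) * S := ENNReal.tsum_mul_right
      _ ≤ S ^ 2 := by rw [sq]; gcongr
  calc oscOp F t ≤ (S ^ 2) ^ (1 / 2 : ℝ) :=
        ENNReal.rpow_le_rpow ((ENNReal.tsum_le_tsum hterm).trans hsq) (by norm_num)
    _ = S := by
        rw [← ENNReal.rpow_natCast, ← ENNReal.rpow_mul]
        norm_num

/-- For `z ≠ 0`, `∫₀^∞ |∂_t(t^k ∂_t^k W_t(z))| dt ≤ C |z|^{-d}`; consequently the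
oscillation of `t ↦ t^k ∂_t^k W_t(z)` along any admissible sequence is at most `C |z|^{-d}`. -/
theorem statement13 (d : ℕ) (hd : 1 ≤ d) (k : ℕ) :
    ∃ C > (0:ℝ), ∀ z : EuclideanSpace ℝ (Fin d), z ≠ 0 →
      (∫⁻ t in Set.Ioi (0:ℝ),
          ENNReal.ofReal
            |deriv (fun s => s ^ k * (deriv^[k] fun u => heatKernel d u z) s) t| ≤
        ENNReal.ofReal (C / ‖z‖ ^ d)) ∧
      ∀ tseq : ℤ → ℝ, (∀ j, 0 < tseq j) → StrictMono tseq →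
        Tendsto tseq atBot (nhds 0) → Tendsto tseq atTop atTop →
        oscOp (fun s => s ^ k * (deriv^[k] fun u => heatKernel d u z) s) tseq ≤
          ENNReal.ofReal (C / ‖z‖ ^ d) := by
  set p : ℝ := (d : ℝ) / 2 with hp_def
  have hp : 0 < p := by
    have : (0 : ℝ) < d := by exact_mod_cast hd
    positivity
  set c : ℝ := (4 * Real.pi) ^ (-(d : ℝ) / 2) with hc_def
  have hc : 0 < c := by positivity
  set P := heatPoly p k with hP
  set J : ℝ := ∫ t in Set.Ioi (0 : ℝ), |t⁻¹ * heatProfile p (eulerOp p P) 1 t| with hJ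
  have hJ0 : 0 ≤ J := integral_nonneg fun t => abs_nonneg _
  refine ⟨c * 2 ^ d * J + 1, by positivity, fun z hz => ?_⟩
  have hz' : 0 < ‖z‖ := norm_pos_iff.2 hz
  set a : ℝ := ‖z‖ ^ 2 / 4 with ha_def
  have ha : 0 < a := by positivity
  set F : ℝ → ℝ := fun s => s ^ k * (deriv^[k] fun u => heatKernel d u z) s with hF
  have hFeq : ∀ t, 0 < t → F t = c * heatProfile p P a t := fun t ht => by
    simp only [hF]
    rw [iterate_deriv_heatKernel z k ht, mul_left_comm, mul_inv_cancel_left₀ (by positivity)]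
  have hFder : ∀ t, 0 < t → HasDerivAt F (c * (t⁻¹ * heatProfile p (eulerOp p P) a t)) t := by
    intro t ht
    refine ((hasDerivAt_heatProfile p P a ht).const_mul c).congr_of_eventuallyEq ?_
    filter_upwards [Ioi_mem_nhds ht] with s hs using hFeq s hs
  have hint : IntegrableOn (deriv F) (Set.Ioi 0) :=
    IntegrableOn.congr_fun ((integrableOn_inv_mul_heatProfile hp (eulerOp p P) ha).const_mul c)
      (fun t ht => (hFder t ht).deriv.symm) measurableSet_Ioi
  have hapow : a ^ (-p) = 2 ^ d / ‖z‖ ^ d := by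
    rw [show a = (‖z‖ / 2) ^ (2 : ℝ) by rw [Real.rpow_two]; ring,
      ← Real.rpow_mul (by positivity), show (2 : ℝ) * -p = -(d : ℝ) by rw [hp_def]; ring,
      Real.rpow_neg (by positivity), Real.rpow_natCast, div_pow, inv_div]
  have hmain : ∫⁻ t in Set.Ioi (0:ℝ), ENNReal.ofReal |deriv F t| ≤
      ENNReal.ofReal ((c * 2 ^ d * J + 1) / ‖z‖ ^ d) := by
    rw [← ofReal_integral_eq_lintegral_ofReal hint.abs (ae_of_all _ fun t => abs_nonneg _)]
    apply ENNReal.ofReal_le_ofReal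
    rw [setIntegral_congr_fun (g := fun t => c * |t⁻¹ * heatProfile p (eulerOp p P) a t|)
      measurableSet_Ioi, integral_const_mul, integral_abs_inv_mul_heatProfile p _ ha, hapow]
    · rw [← hJ, show c * (2 ^ d / ‖z‖ ^ d * J) = c * 2 ^ d * J / ‖z‖ ^ d by ring]
      gcongr
      linarith
    · intro t ht
      simp only
      rw [(hFder t ht).deriv, abs_mul, abs_of_pos hc]
  exact ⟨hmain, fun tseq hpos hmono _ _ => (oscOp_le_lintegral_deriv
    (fun t ht => (hFder t ht).differentiableAt) hint hpos hmono).trans hmain⟩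
end
end
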